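/- arXiv:cs/0412108 — 2 statements merged into one kernel-verified Lean document; each statement's English description precedes it below -/
import Mathlib

section
/- For every probability distribution of X with E[X^2] < ∞ and every snr ≥ 0, the mutual information equals the accumulated MMSE: I(snr) = (1/2) ∫₀^{snr} mmse(γ) dγ. -/
open MeasureTheory ProbabilityTheory Real Filter
open scoped ENNReal NNReal Topology

noncomputable section

open scoped Classical in
/-- Kullback–Leibler divergence `D(μ ‖ ν)` in nats, with values in `[0, ∞]`. -/
def klDiv {α : Type*} [MeasurableSpace α] (μ ν : Measure α) : ℝ≥0∞ :=
  if μ ≪ ν ∧ Integrable (llr μ ν) μ then ENNReal.ofReal (∫ x, llr μ ν x ∂μ) else ⊤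

/-- Mutual information `I(A; B)` in nats: the KL divergence of the joint law of `(A, B)`
from the product of its marginals. -/
def mutualInfo {Ω α β : Type*} [MeasurableSpace Ω] [MeasurableSpace α] [MeasurableSpace β]
    (μ : Measure Ω) (A : Ω → α) (B : Ω → β) : ℝ≥0∞ :=
  klDiv (μ.map fun ω => (A ω, B ω)) ((μ.map A).prod (μ.map B))

/-- Output `Y = √snr · X + N` of the scalar Gaussian channel at signal-to-noise ratio `snr`. -/
def chOut {Ω : Type*} (X N : Ω → ℝ) (snr : ℝ) : Ω → ℝ := fun ω => Real.sqrt snr * X ω + N ω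

/-- Minimum mean-square error `E[(X - E[X | Y])²]` of estimating `X` given `Y`. -/
def mmse {Ω : Type*} [MeasurableSpace Ω] (μ : Measure Ω) (X Y : Ω → ℝ) : ℝ :=
  ∫ ω, (X ω - (μ[X | MeasurableSpace.comap Y inferInstance]) ω) ^ 2 ∂μ


/-- Gaussian weight `exp (-(y - s x)^2 / 2)`. -/
def gw (s y x : ℝ) : ℝ := Real.exp (-(y - s * x) ^ 2 / 2)

/-- Unnormalised output density `∫ exp (-(y - s x)^2 / 2) dP(x)`. -/
def gK (P : Measure ℝ) (s y : ℝ) : ℝ := ∫ x, gw s y x ∂P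

lemma gw_pos (s y x : ℝ) : 0 < gw s y x := Real.exp_pos _

lemma gw_le_one (s y x : ℝ) : gw s y x ≤ 1 := by
  unfold gw
  rw [Real.exp_le_one_iff]
  nlinarith [sq_nonneg (y - s * x)]

lemma measurable_gw (s : ℝ) : Measurable (fun p : ℝ × ℝ => gw s p.2 p.1) := by
  unfold gw; fun_prop

lemma continuous_gw (s y : ℝ) : Continuous (gw s y) := by
  unfold gw; fun_prop

lemma integrable_gw (P : Measure ℝ) [IsProbabilityMeasure P] (s y : ℝ) :
    Integrable (gw s y) P := by
  refine (integrable_const (1 : ℝ)).mono' (continuous_gw s y).aestronglyMeasurable ?_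
  filter_upwards with x
  rw [Real.norm_of_nonneg (gw_pos s y x).le]
  exact gw_le_one s y x

lemma integrable_mul_gw {P : Measure ℝ} {f : ℝ → ℝ} (hf : Integrable f P)
    (s y : ℝ) : Integrable (fun x => f x * gw s y x) P := by
  refine hf.norm.mono' (hf.1.mul (continuous_gw s y).aestronglyMeasurable) ?_
  filter_upwards with x
  rw [norm_mul, Real.norm_of_nonneg (gw_pos s y x).le]
  exact mul_le_of_le_one_right (norm_nonneg _) (gw_le_one s y x)

lemma gK_pos (P : Measure ℝ) [IsProbabilityMeasure P] (s y : ℝ) : 0 < gK P s y := by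
  unfold gK
  rw [integral_pos_iff_support_of_nonneg (fun x => (gw_pos s y x).le) (integrable_gw P s y)]
  have : Function.support (gw s y) = Set.univ := by
    ext x; simp [(gw_pos s y x).ne']
  rw [this]; simp

lemma gK_le_one (P : Measure ℝ) [IsProbabilityMeasure P] (s y : ℝ) : gK P s y ≤ 1 := by
  have := integral_mono (integrable_gw P s y) (integrable_const (1 : ℝ)) (gw_le_one s y)
  simpa [gK] using this

lemma measurable_gK (P : Measure ℝ) [IsProbabilityMeasure P] (s : ℝ) : Measurable (gK P s) := by
  have h : StronglyMeasurable (fun p : ℝ × ℝ => gw s p.2 p.1) := (measurable_gw s).stronglyMeasurable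
  exact h.integral_prod_left'.measurable

lemma integrable_id_of_sq {P : Measure ℝ} [IsProbabilityMeasure P]
    (h2 : Integrable (fun x => x ^ 2) P) : Integrable (fun x : ℝ => x) P := by
  refine (h2.add (integrable_const (1 : ℝ))).mono' aestronglyMeasurable_id ?_
  filter_upwards with x
  simp only [Pi.add_apply, Real.norm_eq_abs]
  rw [abs_le]; constructor <;> nlinarith [sq_nonneg (x - 1), sq_nonneg (x + 1), sq_nonneg x]

lemma integrable_u_sq {P : Measure ℝ} [IsProbabilityMeasure P]
    (h2 : Integrable (fun x => x ^ 2) P) (s y : ℝ) :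
    Integrable (fun x => (y - s * x) ^ 2) P := by
  have h1 := integrable_id_of_sq h2
  have : (fun x => (y - s * x) ^ 2) = fun x => y ^ 2 - (2 * y * s) * x + s ^ 2 * x ^ 2 := by
    funext x; ring
  rw [this]
  exact ((integrable_const _).sub (h1.const_mul _)).add (h2.const_mul _)

/-- second moment of `y - s x` under `P` -/
def gm (P : Measure ℝ) (s y : ℝ) : ℝ := ∫ x, (y - s * x) ^ 2 ∂P

lemma gm_le {P : Measure ℝ} [IsProbabilityMeasure P]
    (h2 : Integrable (fun x => x ^ 2) P) (s y : ℝ) :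
    gm P s y ≤ 2 * y ^ 2 + 2 * s ^ 2 * ∫ x, x ^ 2 ∂P := by
  have h := integral_mono (integrable_u_sq h2 s y)
    ((integrable_const (2 * y ^ 2)).add (h2.const_mul (2 * s ^ 2)))
    (fun x => by
      change (y - s * x) ^ 2 ≤ 2 * y ^ 2 + 2 * s ^ 2 * x ^ 2
      nlinarith [sq_nonneg (y + s * x)])
  rw [integral_add' (integrable_const _) (h2.const_mul _), integral_const, integral_const_mul] at h
  simpa [gm] using h

lemma gm_nonneg (P : Measure ℝ) (s y : ℝ) : 0 ≤ gm P s y :=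
  integral_nonneg fun _ => sq_nonneg _

/-- Jensen lower bound. -/
lemma exp_le_gK {P : Measure ℝ} [IsProbabilityMeasure P]
    (h2 : Integrable (fun x => x ^ 2) P) (s y : ℝ) :
    Real.exp (-(gm P s y) / 2) ≤ gK P s y := by
  have hu := integrable_u_sq h2 s y
  set m := gm P s y with hm
  have h := integral_mono (μ := P) (f := fun x => Real.exp (-m / 2) * (1 + m / 2)
      - Real.exp (-m / 2) / 2 * (y - s * x) ^ 2) (g := gw s y)
    ((integrable_const _).sub (hu.const_mul _)) (integrable_gw P s y)
    (fun x => by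
      change _ ≤ Real.exp (-(y - s * x) ^ 2 / 2)
      have e : Real.exp (-(y - s * x) ^ 2 / 2)
          = Real.exp (-m / 2) * Real.exp (-(y - s * x) ^ 2 / 2 + m / 2) := by
        rw [← Real.exp_add]; congr 1; ring
      rw [e]
      have := Real.add_one_le_exp (-(y - s * x) ^ 2 / 2 + m / 2)
      have := mul_le_mul_of_nonneg_left this (Real.exp_pos (-m / 2)).le
      simp only; linarith)
  rw [integral_sub (integrable_const _) (hu.const_mul _), integral_const, integral_const_mul] at h
  have e2 : ∫ x, (y - s * x) ^ 2 ∂P = m := rfl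
  rw [e2] at h
  simp only [probReal_univ, one_smul] at h
  change _ ≤ gK P s y at h
  linarith

lemma abs_log_gK_le {P : Measure ℝ} [IsProbabilityMeasure P]
    (h2 : Integrable (fun x => x ^ 2) P) (s y : ℝ) :
    |Real.log (gK P s y)| ≤ y ^ 2 + s ^ 2 * ∫ x, x ^ 2 ∂P := by
  have h1 : Real.log (gK P s y) ≤ 0 := Real.log_nonpos (gK_pos P s y).le (gK_le_one P s y)
  have h3 : -(gm P s y) / 2 ≤ Real.log (gK P s y) := by
    rw [Real.le_log_iff_exp_le (gK_pos P s y)]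
    exact exp_le_gK h2 s y
  have := gm_le h2 s y
  rw [abs_of_nonpos h1]
  linarith

/-- Chebyshev's association inequality. -/
lemma integral_u_sq_gw_le {P : Measure ℝ} [IsProbabilityMeasure P]
    (h2 : Integrable (fun x => x ^ 2) P) (s y : ℝ) :
    ∫ x, (y - s * x) ^ 2 * gw s y x ∂P ≤ gm P s y * gK P s y := by
  have hu := integrable_u_sq h2 s y
  have huw := integrable_mul_gw hu s y
  set m := gm P s y with hm
  have h := integral_mono (μ := P) (f := fun x => (y - s * x) ^ 2 * gw s y x)
    (g := fun x => m * gw s y x + (Real.exp (-m / 2) * (y - s * x) ^ 2 - Real.exp (-m / 2) * m))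
    huw (((integrable_gw P s y).const_mul m).add ((hu.const_mul _).sub (integrable_const _)))
    (fun x => by
      have key : ((y - s * x) ^ 2 - m) * (gw s y x - Real.exp (-m / 2)) ≤ 0 := by
        rcases le_total ((y - s * x) ^ 2) m with hh | hh
        · have : Real.exp (-m / 2) ≤ gw s y x := Real.exp_le_exp.2 (by linarith)
          exact mul_nonpos_of_nonpos_of_nonneg (by linarith) (by linarith)
        · have : gw s y x ≤ Real.exp (-m / 2) := Real.exp_le_exp.2 (by linarith)
          exact mul_nonpos_of_nonneg_of_nonpos (by linarith) (by linarith)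
      simp only; linarith)
  have hsub : Integrable (fun x => Real.exp (-m / 2) * (y - s * x) ^ 2 - Real.exp (-m / 2) * m) P :=
    (hu.const_mul _).sub (integrable_const _)
  rw [integral_add ((integrable_gw P s y).const_mul m) hsub,
    integral_sub (hu.const_mul _) (integrable_const _), integral_const, integral_const_mul,
    integral_const_mul] at h
  have e2 : ∫ x, (y - s * x) ^ 2 ∂P = m := rfl
  have e3 : ∫ x, gw s y x ∂P = gK P s y := rfl
  rw [e2, e3] at h
  simp only [probReal_univ, one_smul] at h
  linarith

/-- Pathwise derivative of `s ↦ K(s, s a + n)`. -/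
lemma hasDerivAt_gK {P : Measure ℝ} [IsProbabilityMeasure P]
    (h2 : Integrable (fun x => x ^ 2) P) (a n s : ℝ) :
    HasDerivAt (fun s => gK P s (s * a + n))
      (-∫ x, (a - x) * (s * a + n - s * x) * gw s (s * a + n) x ∂P) s := by
  have h1 := integrable_id_of_sq h2
  have := (hasDerivAt_integral_of_dominated_loc_of_deriv_le (μ := P) (s := Set.univ) (x₀ := s)
    (F := fun s x => gw s (s * a + n) x)
    (F' := fun s x => -((a - x) * (s * a + n - s * x) * gw s (s * a + n) x))
    (bound := fun x => |a - x|) Filter.univ_mem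
    (Filter.Eventually.of_forall fun s => (continuous_gw s _).aestronglyMeasurable)
    (integrable_gw P s _)
    (by
      have := continuous_gw s (s * a + n)
      exact Continuous.aestronglyMeasurable (by fun_prop))
    (by
      filter_upwards with x
      intro t _
      rw [norm_neg, norm_mul, norm_mul, mul_assoc, Real.norm_eq_abs (a - x)]
      refine mul_le_of_le_one_right (abs_nonneg _) ?_
      rw [Real.norm_eq_abs, Real.norm_of_nonneg (gw_pos _ _ _).le]
      set u := t * a + n - t * x with hu
      have hb : |u| ≤ Real.exp (u ^ 2 / 2) := by
        have h3 := Real.add_one_le_exp (u ^ 2 / 2)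
        have h4 : |u| ≤ u ^ 2 / 2 + 1 := by
          rw [← sq_abs]; nlinarith [sq_nonneg (|u| - 1)]
        linarith
      have : gw t (t * a + n) x = (Real.exp (u ^ 2 / 2))⁻¹ := by
        rw [← Real.exp_neg]; unfold gw; congr 1; ring
      rw [this, ← div_eq_mul_inv]
      exact div_le_one_of_le₀ hb (Real.exp_pos _).le)
    (((integrable_const a).sub h1).abs)
    (by
      filter_upwards with x
      intro t _
      unfold gw
      have hd : HasDerivAt (fun t : ℝ => t * a + n - t * x) (a - x) t := by
        exact ((((hasDerivAt_id t).mul_const a).add_const n).sub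
          ((hasDerivAt_id t).mul_const x)).congr_deriv (by ring)
      exact ((((hd.pow 2).neg).div_const 2).exp).congr_deriv (by simp; ring))).2
  rw [← integral_neg]
  exact this

lemma hasDerivAt_log_gK {P : Measure ℝ} [IsProbabilityMeasure P]
    (h2 : Integrable (fun x => x ^ 2) P) (a n s : ℝ) :
    HasDerivAt (fun s => -Real.log (gK P s (s * a + n)))
      ((∫ x, (a - x) * (s * a + n - s * x) * gw s (s * a + n) x ∂P) / gK P s (s * a + n)) s := by
  exact (((hasDerivAt_gK h2 a n s).log (gK_pos P s _).ne').neg).congr_deriv (by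
    rw [neg_div, neg_neg])

lemma deriv_bound {P : Measure ℝ} [IsProbabilityMeasure P]
    (h2 : Integrable (fun x => x ^ 2) P) (a n s : ℝ) (hs : 0 < s) :
    |(∫ x, (a - x) * (s * a + n - s * x) * gw s (s * a + n) x ∂P) / gK P s (s * a + n)|
      ≤ (2 * gm P s (s * a + n) + n ^ 2) / s := by
  have hK := gK_pos P s (s * a + n)
  have hu := integrable_u_sq h2 s (s * a + n)
  have huw := integrable_mul_gw hu s (s * a + n)
  have hw := integrable_gw P s (s * a + n)
  rw [abs_div, abs_of_pos hK, div_le_iff₀ hK, div_mul_eq_mul_div, le_div_iff₀ hs]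
  have hle : |∫ x, (a - x) * (s * a + n - s * x) * gw s (s * a + n) x ∂P| * s
      ≤ 2 * (∫ x, (s * a + n - s * x) ^ 2 * gw s (s * a + n) x ∂P)
        + n ^ 2 * gK P s (s * a + n) := by
    rw [← abs_of_pos hs, ← abs_mul, abs_of_pos hs, ← integral_mul_const, ← Real.norm_eq_abs]
    have := norm_integral_le_of_norm_le (μ := P)
      (f := fun x => (a - x) * (s * a + n - s * x) * gw s (s * a + n) x * s)
      (g := fun x => 2 * ((s * a + n - s * x) ^ 2 * gw s (s * a + n) x)
        + n ^ 2 * gw s (s * a + n) x)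
      ((huw.const_mul 2).add (hw.const_mul _))
      (by
        filter_upwards with x
        set u := s * a + n - s * x with hu
        have e : (a - x) * u * gw s (s * a + n) x * s = ((u - n) * u) * gw s (s * a + n) x := by
          rw [hu]; ring
        rw [e, norm_mul, Real.norm_of_nonneg (gw_pos _ _ _).le, ← mul_assoc, ← add_mul]
        refine mul_le_mul_of_nonneg_right ?_ (gw_pos _ _ _).le
        rw [Real.norm_eq_abs, abs_le]
        constructor <;> nlinarith [sq_nonneg (u - n), sq_nonneg (u + n), sq_nonneg u, sq_nonneg n])
    rw [integral_add (huw.const_mul 2) (hw.const_mul _), integral_const_mul,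
      integral_const_mul] at this
    exact this
  have := integral_u_sq_gw_le h2 s (s * a + n)
  nlinarith

lemma gaussianPDF_eq_gw (s y x : ℝ) :
    gaussianPDF 0 1 (y - s * x) = ENNReal.ofReal ((√(2 * π))⁻¹ * gw s y x) := by
  simp [gaussianPDF, gaussianPDFReal, gw]

section Joint

variable {Ω : Type*} [MeasurableSpace Ω] {μ : Measure Ω} [IsProbabilityMeasure μ] {X N : Ω → ℝ}

lemma joint_lintegral (hX : Measurable X) (hN : Measurable N)
    (hXN : IndepFun X N μ) (hN_law : μ.map N = gaussianReal 0 1) (s : ℝ)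
    {f : ℝ × ℝ → ℝ≥0∞} (hf : Measurable f) :
    ∫⁻ p, f p ∂(μ.map fun ω => (X ω, s * X ω + N ω))
      = ∫⁻ y, ∫⁻ x, f (x, y) * ENNReal.ofReal ((√(2 * π))⁻¹ * gw s y x) ∂(μ.map X) := by
  have : IsProbabilityMeasure (μ.map X) := Measure.isProbabilityMeasure_map hX.aemeasurable
  have hmap := (indepFun_iff_map_prod_eq_prod_map_map hX.aemeasurable hN.aemeasurable).1 hXN
  have hcomp : (μ.map fun ω => (X ω, s * X ω + N ω))
      = (μ.map fun ω => (X ω, N ω)).map (fun p : ℝ × ℝ => (p.1, s * p.1 + p.2)) := by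
    rw [Measure.map_map (by fun_prop) (by fun_prop)]; rfl
  have hg : Measurable (fun p : ℝ × ℝ => gaussianPDF 0 1 (p.2 - s * p.1)) :=
    (measurable_gaussianPDF 0 1).comp (by fun_prop)
  have hm1 : Measurable (fun p : ℝ × ℝ => (p.1, s * p.1 + p.2)) := by fun_prop
  have hfm1 : Measurable (fun p : ℝ × ℝ => f (p.1, s * p.1 + p.2)) := hf.comp hm1
  rw [hcomp, hmap, hN_law, lintegral_map hf hm1, lintegral_prod _ hfm1.aemeasurable,
    gaussianReal_of_var_ne_zero 0 one_ne_zero]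
  simp_rw [← gaussianPDF_eq_gw]
  have hfg : Measurable (fun p : ℝ × ℝ => f p * gaussianPDF 0 1 (p.2 - s * p.1)) := hf.mul hg
  rw [← lintegral_prod_symm' (μ := μ.map X) (ν := volume)
    (fun p : ℝ × ℝ => f p * gaussianPDF 0 1 (p.2 - s * p.1)) hfg,
    lintegral_prod _ hfg.aemeasurable]
  refine lintegral_congr fun x => ?_
  have hfx : Measurable (fun n : ℝ => f (x, s * x + n)) := hf.comp (by fun_prop)
  rw [lintegral_withDensity_eq_lintegral_mul _ (measurable_gaussianPDF 0 1) hfx]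
  rw [← lintegral_add_left_eq_self (fun y => f (x, y) * gaussianPDF 0 1 (y - s * x)) (s * x)]
  refine lintegral_congr fun n => ?_
  simp only [Pi.mul_apply, add_sub_cancel_left]
  rw [mul_comm]

lemma joint_pointwise (P : Measure ℝ) [IsProbabilityMeasure P] (s : ℝ) {A : Set (ℝ × ℝ)}
    (hA : MeasurableSet A) (y : ℝ) :
    ∫⁻ x, A.indicator (1 : ℝ × ℝ → ℝ≥0∞) (x, y) * ENNReal.ofReal ((√(2 * π))⁻¹ * gw s y x) ∂P
      = ∫⁻ x', (∫⁻ x, A.indicator (fun p => ENNReal.ofReal (gw s p.2 p.1 / gK P s p.2)) (x, y) ∂P)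
        * ENNReal.ofReal ((√(2 * π))⁻¹ * gw s y x') ∂P := by
  have hr : Measurable (fun p : ℝ × ℝ => ENNReal.ofReal (gw s p.2 p.1 / gK P s p.2)) :=
    ((measurable_gw s).div ((measurable_gK P s).comp measurable_snd)).ennreal_ofReal
  have hK := gK_pos P s y
  obtain ⟨c, hc, hceq⟩ : ∃ c : ℝ, 0 < c ∧ c = (√(2 * π))⁻¹ := ⟨_, by positivity, rfl⟩
  rw [← hceq]
  have hwy : Measurable (fun x : ℝ => ENNReal.ofReal (c * gw s y x)) :=
    ((continuous_gw s y).measurable.const_mul c).ennreal_ofReal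
  have hκ : ∫⁻ x, ENNReal.ofReal (c * gw s y x) ∂P = ENNReal.ofReal (c * gK P s y) := by
    rw [← ofReal_integral_eq_lintegral_ofReal ((integrable_gw P s y).const_mul _)
      (ae_of_all _ fun x => (mul_pos hc (gw_pos s y x)).le), integral_const_mul, gK]
  have hrA : Measurable (fun x : ℝ => A.indicator
      (fun p => ENNReal.ofReal (gw s p.2 p.1 / gK P s p.2)) (x, y)) :=
    (hr.indicator hA).comp (by fun_prop : Measurable fun x : ℝ => (x, y))
  rw [lintegral_const_mul _ hwy, hκ, ← lintegral_mul_const _ hrA]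
  refine lintegral_congr fun x => ?_
  by_cases hx : (x, y) ∈ A
  · simp only [Set.indicator_of_mem hx, Pi.one_apply, one_mul]
    rw [← ENNReal.ofReal_mul (div_pos (gw_pos s y x) hK).le]
    congr 1
    field_simp
  · simp only [Set.indicator_of_notMem hx, zero_mul]

/-- The joint law has density `w / K` with respect to the product of marginals. -/
lemma joint_eq_withDensity (hX : Measurable X) (hN : Measurable N)
    (hXN : IndepFun X N μ) (hN_law : μ.map N = gaussianReal 0 1) (s : ℝ) :
    (μ.map fun ω => (X ω, s * X ω + N ω))
      = ((μ.map X).prod (μ.map fun ω => s * X ω + N ω)).withDensity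
        (fun p => ENNReal.ofReal (gw s p.2 p.1 / gK (μ.map X) s p.2)) := by
  have : IsProbabilityMeasure (μ.map X) := Measure.isProbabilityMeasure_map hX.aemeasurable
  have hY : Measurable (fun ω => s * X ω + N ω) := by fun_prop
  have : IsProbabilityMeasure (μ.map fun ω => s * X ω + N ω) :=
    Measure.isProbabilityMeasure_map hY.aemeasurable
  have hr : Measurable (fun p : ℝ × ℝ => ENNReal.ofReal (gw s p.2 p.1 / gK (μ.map X) s p.2)) :=
    ((measurable_gw s).div ((measurable_gK (μ.map X) s).comp measurable_snd)).ennreal_ofReal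
  have hw : Measurable (fun p : ℝ × ℝ => ENNReal.ofReal ((√(2 * π))⁻¹ * gw s p.2 p.1)) :=
    ((measurable_gw s).const_mul _).ennreal_ofReal
  ext A hA
  have hind : Measurable (A.indicator (1 : ℝ × ℝ → ℝ≥0∞)) := measurable_one.indicator hA
  rw [withDensity_apply _ hA, ← lintegral_indicator hA, lintegral_prod_symm' _ (hr.indicator hA),
    ← lintegral_indicator_one hA, joint_lintegral hX hN hXN hN_law s hind]
  have hG : Measurable (fun y => ∫⁻ x, A.indicator
      (fun p => ENNReal.ofReal (gw s p.2 p.1 / gK (μ.map X) s p.2)) (x, y) ∂(μ.map X)) :=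
    (hr.indicator hA).lintegral_prod_left'
  have hsnd : (μ.map fun ω => s * X ω + N ω)
      = (μ.map fun ω => (X ω, s * X ω + N ω)).map Prod.snd := by
    rw [Measure.map_map (by fun_prop) (by fun_prop)]; rfl
  have hG2 : Measurable (fun p : ℝ × ℝ => ∫⁻ x, A.indicator
      (fun p => ENNReal.ofReal (gw s p.2 p.1 / gK (μ.map X) s p.2)) (x, p.2) ∂(μ.map X)) := hG.comp measurable_snd
  rw [hsnd, lintegral_map hG measurable_snd,
    joint_lintegral hX hN hXN hN_law s hG2]
  refine lintegral_congr fun y => ?_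
  exact joint_pointwise (μ.map X) s hA y

/-- `i(s) = E[-N²/2 - log K(s, Y)]`. -/
def gH (μ : Measure Ω) (X N : Ω → ℝ) (s : ℝ) : ℝ :=
  ∫ ω, (-(N ω) ^ 2 / 2 + -Real.log (gK (μ.map X) s (s * X ω + N ω))) ∂μ

lemma integrable_map_sq (hX : Measurable X) (hX2 : Integrable (fun ω => X ω ^ 2) μ) :
    Integrable (fun x : ℝ => x ^ 2) (μ.map X) :=
  (integrable_map_measure (by fun_prop) hX.aemeasurable).2 hX2

lemma integrable_N_sq (hN : Measurable N) (hN_law : μ.map N = gaussianReal 0 1) :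
    Integrable (fun ω => N ω ^ 2) μ := by
  have h : Integrable (fun x : ℝ => x ^ 2) (μ.map N) := by
    rw [hN_law]
    exact (memLp_id_gaussianReal 2).integrable_sq
  exact (integrable_map_measure (by fun_prop) hN.aemeasurable).1 h

lemma abs_log_path_le (hX : Measurable X)
    (hX2 : Integrable (fun ω => X ω ^ 2) μ) (s : ℝ) (ω : Ω) :
    |Real.log (gK (μ.map X) s (s * X ω + N ω))|
      ≤ 2 * s ^ 2 * X ω ^ 2 + 2 * N ω ^ 2 + s ^ 2 * ∫ x, x ^ 2 ∂(μ.map X) := by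
  have : IsProbabilityMeasure (μ.map X) := Measure.isProbabilityMeasure_map hX.aemeasurable
  have := abs_log_gK_le (integrable_map_sq hX hX2) s (s * X ω + N ω)
  nlinarith [sq_nonneg (s * X ω - N ω)]

lemma measurable_log_path (hX : Measurable X) (hN : Measurable N) (s : ℝ) :
    Measurable (fun ω => Real.log (gK (μ.map X) s (s * X ω + N ω))) := by
  have : IsProbabilityMeasure (μ.map X) := Measure.isProbabilityMeasure_map hX.aemeasurable
  exact ((measurable_gK (μ.map X) s).comp (by fun_prop)).log

lemma integrable_log_path (hX : Measurable X) (hN : Measurable N)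
    (hN_law : μ.map N = gaussianReal 0 1) (hX2 : Integrable (fun ω => X ω ^ 2) μ) (s : ℝ) :
    Integrable (fun ω => Real.log (gK (μ.map X) s (s * X ω + N ω))) μ := by
  refine (((hX2.const_mul (2 * s ^ 2)).add ((integrable_N_sq hN hN_law).const_mul 2)).add
    (integrable_const (s ^ 2 * ∫ x, x ^ 2 ∂(μ.map X)))).mono'
    (measurable_log_path hX hN s).aestronglyMeasurable ?_
  filter_upwards with ω
  exact abs_log_path_le hX hX2 s ω

lemma integrable_path (hX : Measurable X) (hN : Measurable N)
    (hN_law : μ.map N = gaussianReal 0 1) (hX2 : Integrable (fun ω => X ω ^ 2) μ) (s : ℝ) :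
    Integrable (fun ω => -(N ω) ^ 2 / 2 + -Real.log (gK (μ.map X) s (s * X ω + N ω))) μ :=
  ((integrable_N_sq hN hN_law).neg.div_const 2).add (integrable_log_path hX hN hN_law hX2 s).neg

lemma mutualInfo_eq_ofReal_gH (hX : Measurable X) (hN : Measurable N)
    (hXN : IndepFun X N μ) (hN_law : μ.map N = gaussianReal 0 1)
    (hX2 : Integrable (fun ω => X ω ^ 2) μ) (s : ℝ) :
    mutualInfo μ X (fun ω => s * X ω + N ω) = ENNReal.ofReal (gH μ X N s) := by
  have : IsProbabilityMeasure (μ.map X) := Measure.isProbabilityMeasure_map hX.aemeasurable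
  have hY : Measurable (fun ω => s * X ω + N ω) := by fun_prop
  have : IsProbabilityMeasure (μ.map fun ω => s * X ω + N ω) :=
    Measure.isProbabilityMeasure_map hY.aemeasurable
  have hden := joint_eq_withDensity hX hN hXN hN_law s
  have hr : Measurable (fun p : ℝ × ℝ => ENNReal.ofReal (gw s p.2 p.1 / gK (μ.map X) s p.2)) :=
    ((measurable_gw s).div ((measurable_gK (μ.map X) s).comp measurable_snd)).ennreal_ofReal
  have hXY : Measurable (fun ω => (X ω, s * X ω + N ω)) := hX.prodMk hY
  set J := μ.map fun ω => (X ω, s * X ω + N ω) with hJ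
  set Q := (μ.map X).prod (μ.map fun ω => s * X ω + N ω) with hQ
  have hac : J ≪ Q := by rw [hden]; exact withDensity_absolutelyContinuous _ _
  have hllr : llr J Q =ᵐ[J] fun p => Real.log (gw s p.2 p.1 / gK (μ.map X) s p.2) := by
    have h1 : J.rnDeriv Q =ᵐ[Q] fun p => ENNReal.ofReal (gw s p.2 p.1 / gK (μ.map X) s p.2) := by
      conv_lhs => rw [hden]
      exact Measure.rnDeriv_withDensity Q hr
    filter_upwards [hac.ae_le h1] with p hp
    rw [llr, hp, ENNReal.toReal_ofReal (div_pos (gw_pos _ _ _) (gK_pos _ _ _)).le]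
  have hm : Measurable (fun p : ℝ × ℝ => Real.log (gw s p.2 p.1 / gK (μ.map X) s p.2)) :=
    ((measurable_gw s).div ((measurable_gK (μ.map X) s).comp measurable_snd)).log
  have hpath : ∀ ω, Real.log (gw s (s * X ω + N ω) (X ω) / gK (μ.map X) s (s * X ω + N ω))
      = -(N ω) ^ 2 / 2 + -Real.log (gK (μ.map X) s (s * X ω + N ω)) := by
    intro ω
    rw [Real.log_div (gw_pos _ _ _).ne' (gK_pos _ _ _).ne', gw, Real.log_exp, add_sub_cancel_left]
    ring
  have hint : Integrable (llr J Q) J := by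
    rw [integrable_congr hllr, hJ, integrable_map_measure hm.aestronglyMeasurable hXY.aemeasurable]
    refine (integrable_path hX hN hN_law hX2 s).congr ?_
    filter_upwards with ω
    exact (hpath ω).symm
  have hval : ∫ p, llr J Q p ∂J = gH μ X N s := by
    rw [integral_congr_ae hllr, hJ, integral_map hXY.aemeasurable hm.aestronglyMeasurable]
    exact integral_congr_ae (ae_of_all _ hpath)
  unfold mutualInfo klDiv
  rw [if_pos ⟨hac, hint⟩, hval]

/-- Bayes' formula. -/
lemma bayes (hX : Measurable X) (hN : Measurable N)
    (hXN : IndepFun X N μ) (hN_law : μ.map N = gaussianReal 0 1) (s : ℝ)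
    {f : ℝ → ℝ} (hf : Measurable f) (hfX : Integrable (fun ω => f (X ω)) μ) :
    (fun ω => (∫ x, f x * gw s (s * X ω + N ω) x ∂(μ.map X)) / gK (μ.map X) s (s * X ω + N ω))
      =ᵐ[μ] μ[fun ω => f (X ω) | MeasurableSpace.comap (fun ω => s * X ω + N ω) inferInstance] := by
  have : IsProbabilityMeasure (μ.map X) := Measure.isProbabilityMeasure_map hX.aemeasurable
  have hY : Measurable (fun ω => s * X ω + N ω) := by fun_prop
  have : IsProbabilityMeasure (μ.map fun ω => s * X ω + N ω) :=
    Measure.isProbabilityMeasure_map hY.aemeasurable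
  have hden := joint_eq_withDensity hX hN hXN hN_law s
  have hrr : Measurable (fun p : ℝ × ℝ => (gw s p.2 p.1 / gK (μ.map X) s p.2)) :=
    ((measurable_gw s).div ((measurable_gK (μ.map X) s).comp measurable_snd))
  have hXY : Measurable (fun ω => (X ω, s * X ω + N ω)) := hX.prodMk hY
  set J := μ.map fun ω => (X ω, s * X ω + N ω) with hJ
  set P := μ.map X with hP
  set Q := μ.map fun ω => s * X ω + N ω with hQ
  have hfm : Measurable (fun p : ℝ × ℝ => f p.1) := hf.comp measurable_fst
  have hfJ : Integrable (fun p : ℝ × ℝ => f p.1) J :=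
    (integrable_map_measure hfm.aestronglyMeasurable hXY.aemeasurable).2 hfX
  have htoR : ∀ p : ℝ × ℝ, (ENNReal.ofReal (gw s p.2 p.1 / gK P s p.2)).toReal
      = gw s p.2 p.1 / gK P s p.2 := fun p =>
    ENNReal.toReal_ofReal (div_pos (gw_pos _ _ _) (gK_pos _ _ _)).le
  have hfr : Integrable (fun p : ℝ × ℝ => (gw s p.2 p.1 / gK P s p.2) * f p.1) (P.prod Q) := by
    rw [hden, integrable_withDensity_iff_integrable_smul' hrr.ennreal_ofReal
      (ae_of_all _ fun _ => ENNReal.ofReal_lt_top)] at hfJ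
    simpa only [htoR, smul_eq_mul] using hfJ
  have hGeq : ∀ y, ∫ x, (gw s y x / gK P s y) * f x ∂P = (∫ x, f x * gw s y x ∂P) / gK P s y := by
    intro y
    rw [← integral_div]
    congr 1; funext x; ring
  have hGm : Measurable (fun y => (∫ x, f x * gw s y x ∂P) / gK P s y) := by
    have h : StronglyMeasurable (fun p : ℝ × ℝ => f p.1 * gw s p.2 p.1) :=
      (hfm.mul (measurable_gw s)).stronglyMeasurable
    exact h.integral_prod_left'.measurable.div (measurable_gK P s)
  have hGint : Integrable (fun y => (∫ x, f x * gw s y x ∂P) / gK P s y) Q := by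
    have := hfr.integral_prod_right
    simpa only [hGeq] using this
  have hGμ : Integrable (fun ω => (∫ x, f x * gw s (s * X ω + N ω) x ∂P)
      / gK P s (s * X ω + N ω)) μ :=
    (integrable_map_measure hGm.aestronglyMeasurable hY.aemeasurable).1 hGint
  refine ae_eq_condExp_of_forall_setIntegral_eq hY.comap_le hfX (fun _ _ _ => hGμ.integrableOn) ?_ ?_
  · rintro _ ⟨B, hB, rfl⟩ _
    have hl := setIntegral_map (μ := μ) (g := fun ω => s * X ω + N ω) hB
      hGm.aestronglyMeasurable hY.aemeasurable
    have hr := setIntegral_map (μ := μ) (g := fun ω => (X ω, s * X ω + N ω)) (measurable_snd hB)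
      hfm.aestronglyMeasurable hXY.aemeasurable
    refine hl.symm.trans (Eq.trans ?_ hr)
    rw [← hJ, ← hQ, hden, setIntegral_withDensity_eq_setIntegral_toReal_smul
      hrr.ennreal_ofReal (ae_of_all _ fun _ => ENNReal.ofReal_lt_top) _ (measurable_snd hB)]
    have e : (Prod.snd ⁻¹' B : Set (ℝ × ℝ)) = Set.univ ×ˢ B := by ext; simp
    simp only [htoR, smul_eq_mul]
    rw [e, ← Measure.prod_restrict, Measure.restrict_univ, integral_prod_symm]
    · simp only [hGeq]
    · have := hfr.restrict (s := Set.univ ×ˢ B)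
      rwa [← Measure.prod_restrict, Measure.restrict_univ] at this
  · exact (hGm.comp (comap_measurable _)).stronglyMeasurable.aestronglyMeasurable

end Joint

section Deriv

variable {Ω : Type*} [MeasurableSpace Ω] {μ : Measure Ω} [IsProbabilityMeasure μ] {X N : Ω → ℝ}

lemma integral_mul_condExp_eq {Ω : Type*} {m m0 : MeasurableSpace Ω} {μ : Measure Ω}
    [IsProbabilityMeasure μ] (hm : m ≤ m0) {Z X : Ω → ℝ} (hZ : StronglyMeasurable[m] Z)
    (hZX : Integrable (fun ω => Z ω * X ω) μ) (hX : Integrable X μ) :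
    ∫ ω, Z ω * (μ[X | m]) ω ∂μ = ∫ ω, Z ω * X ω ∂μ := by
  have h := condExp_mul_of_stronglyMeasurable_left hZ hZX hX
  have h2 : ∫ ω, (μ[Z * X | m]) ω ∂μ = ∫ ω, (Z * X) ω ∂μ := integral_condExp hm
  rw [integral_congr_ae h] at h2
  exact h2

/-- The pathwise derivative is integrable with expectation `s * mmse`. -/
lemma integral_path_deriv (hX : Measurable X) (hN : Measurable N)
    (hXN : IndepFun X N μ) (hN_law : μ.map N = gaussianReal 0 1)
    (hX2 : Integrable (fun ω => X ω ^ 2) μ) (s : ℝ) :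
    Integrable (fun ω => (∫ x, (X ω - x) * (s * X ω + N ω - s * x) * gw s (s * X ω + N ω) x ∂(μ.map X))
      / gK (μ.map X) s (s * X ω + N ω)) μ ∧
    ∫ ω, (∫ x, (X ω - x) * (s * X ω + N ω - s * x) * gw s (s * X ω + N ω) x ∂(μ.map X))
      / gK (μ.map X) s (s * X ω + N ω) ∂μ = s * mmse μ X (fun ω => s * X ω + N ω) := by
  have : IsProbabilityMeasure (μ.map X) := Measure.isProbabilityMeasure_map hX.aemeasurable
  have hP2 := integrable_map_sq hX hX2
  have hP1 := integrable_id_of_sq hP2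
  have hY : Measurable (fun ω => s * X ω + N ω) := by fun_prop
  have hXL : MemLp X 2 μ := (memLp_two_iff_integrable_sq hX.aestronglyMeasurable).2 hX2
  have hNL : MemLp N 2 μ :=
    (memLp_two_iff_integrable_sq hN.aestronglyMeasurable).2 (integrable_N_sq hN hN_law)
  have hYL : MemLp (fun ω => s * X ω + N ω) 2 μ := (hXL.const_mul s).add hNL
  have hX1 : Integrable X μ := hXL.integrable (by norm_num)
  have hb1 := bayes hX hN hXN hN_law s (f := fun x => x) measurable_id hX1
  have hb2 := bayes hX hN hXN hN_law s (f := fun x => x ^ 2) (by fun_prop) hX2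
  have hmle := hY.comap_le
  have hgm : StronglyMeasurable[MeasurableSpace.comap (fun ω => s * X ω + N ω) inferInstance]
      (μ[X | MeasurableSpace.comap (fun ω => s * X ω + N ω) inferInstance]) :=
    stronglyMeasurable_condExp
  have hYm : StronglyMeasurable[MeasurableSpace.comap (fun ω => s * X ω + N ω) inferInstance]
      (fun ω => s * X ω + N ω) :=
    (comap_measurable (fun ω => s * X ω + N ω)).stronglyMeasurable
  set g := μ[X | MeasurableSpace.comap (fun ω => s * X ω + N ω) inferInstance] with hg
  set h := μ[fun ω => X ω ^ 2 | MeasurableSpace.comap (fun ω => s * X ω + N ω) inferInstance] with hh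
  have hgL : MemLp g 2 μ := hXL.condExp (by norm_num)
  have iXY : Integrable (fun ω => (s * X ω + N ω) * X ω) μ := hYL.integrable_mul hXL
  have iXg : Integrable (fun ω => g ω * X ω) μ := hgL.integrable_mul hXL
  have iYg : Integrable (fun ω => (s * X ω + N ω) * g ω) μ := hYL.integrable_mul hgL
  have igg : Integrable (fun ω => g ω * g ω) μ := hgL.integrable_mul hgL
  have ih : Integrable h μ := integrable_condExp
  have eh : ∫ ω, h ω ∂μ = ∫ ω, X ω ^ 2 ∂μ := integral_condExp hmle
  have eYg : ∫ ω, (s * X ω + N ω) * g ω ∂μ = ∫ ω, (s * X ω + N ω) * X ω ∂μ :=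
    integral_mul_condExp_eq hmle hYm iXY hX1
  have egg : ∫ ω, g ω * g ω ∂μ = ∫ ω, g ω * X ω ∂μ :=
    integral_mul_condExp_eq hmle hgm iXg hX1
  have hD : (fun ω => (∫ x, (X ω - x) * (s * X ω + N ω - s * x) * gw s (s * X ω + N ω) x ∂(μ.map X))
      / gK (μ.map X) s (s * X ω + N ω)) =ᵐ[μ]
      fun ω => ((s * X ω + N ω) * X ω - s * (g ω * X ω)) + (s * h ω - (s * X ω + N ω) * g ω) := by
    filter_upwards [hb1, hb2] with ω h1 h2
    rw [← h1, ← h2]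
    set y := s * X ω + N ω with hy
    have hK := gK_pos (μ.map X) s y
    have i1 := integrable_mul_gw hP1 s y
    have i2 := integrable_mul_gw hP2 s y
    have i0 := integrable_gw (μ.map X) s y
    have e : ∫ x, (X ω - x) * (y - s * x) * gw s y x ∂(μ.map X)
        = (X ω * y * gK (μ.map X) s y - (s * X ω + y) * ∫ x, x * gw s y x ∂(μ.map X))
          + s * ∫ x, x ^ 2 * gw s y x ∂(μ.map X) := by
      rw [gK, ← integral_const_mul, ← integral_const_mul, ← integral_const_mul,
        ← integral_sub (i0.const_mul _) (i1.const_mul _), ← integral_add _ (i2.const_mul _)]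
      · congr 1; funext x; ring
      · exact (i0.const_mul _).sub (i1.const_mul _)
    rw [e]
    field_simp
    ring
  have iR1 : Integrable (fun ω => (s * X ω + N ω) * X ω - s * (g ω * X ω)) μ :=
    iXY.sub (iXg.const_mul s)
  have iR2 : Integrable (fun ω => s * h ω - (s * X ω + N ω) * g ω) μ :=
    (ih.const_mul s).sub iYg
  refine ⟨(iR1.add iR2).congr hD.symm, ?_⟩
  rw [integral_congr_ae hD, integral_add iR1 iR2, integral_sub iXY (iXg.const_mul s),
    integral_sub (ih.const_mul s) iYg, integral_const_mul, integral_const_mul, eh, eYg]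
  have emm : mmse μ X (fun ω => s * X ω + N ω)
      = ∫ ω, X ω ^ 2 ∂μ - 2 * ∫ ω, g ω * X ω ∂μ + ∫ ω, g ω * g ω ∂μ := by
    unfold mmse
    rw [← integral_const_mul, ← integral_sub hX2 (iXg.const_mul 2), ← integral_add _ igg]
    · congr 1; funext ω; ring
    · exact hX2.sub (iXg.const_mul 2)
  rw [emm, egg]
  ring

lemma hasDerivAt_gH (hX : Measurable X) (hN : Measurable N)
    (hXN : IndepFun X N μ) (hN_law : μ.map N = gaussianReal 0 1)
    (hX2 : Integrable (fun ω => X ω ^ 2) μ) {s : ℝ} (hs : 0 < s) :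
    HasDerivAt (gH μ X N) (s * mmse μ X (fun ω => s * X ω + N ω)) s := by
  have : IsProbabilityMeasure (μ.map X) := Measure.isProbabilityMeasure_map hX.aemeasurable
  have hP2 := integrable_map_sq hX hX2
  have hN2 := integrable_N_sq hN hN_law
  obtain ⟨hDi, hDe⟩ := integral_path_deriv hX hN hXN hN_law hX2 s
  rw [← hDe]
  refine (hasDerivAt_integral_of_dominated_loc_of_deriv_le (μ := μ) (s := Set.Ioo (s / 2) (2 * s))
    (x₀ := s)
    (F := fun t ω => -(N ω) ^ 2 / 2 + -Real.log (gK (μ.map X) t (t * X ω + N ω)))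
    (F' := fun t ω => (∫ x, (X ω - x) * (t * X ω + N ω - t * x) * gw t (t * X ω + N ω) x ∂(μ.map X))
      / gK (μ.map X) t (t * X ω + N ω))
    (bound := fun ω => 16 * s * X ω ^ 2 + (18 / s) * N ω ^ 2 + 8 * s * ∫ x, x ^ 2 ∂(μ.map X))
    (Ioo_mem_nhds (by linarith) (by linarith))
    (Filter.Eventually.of_forall fun t => (integrable_path hX hN hN_law hX2 t).1)
    (integrable_path hX hN hN_law hX2 s) hDi.1 ?_
    (((hX2.const_mul _).add (hN2.const_mul _)).add (integrable_const _)) ?_).2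
  · filter_upwards with ω
    rintro t ⟨ht1, ht2⟩
    have ht : 0 < t := by linarith
    have hb := deriv_bound hP2 (X ω) (N ω) t ht
    have hg := gm_le hP2 t (t * X ω + N ω)
    have hM : 0 ≤ ∫ x, x ^ 2 ∂(μ.map X) := integral_nonneg fun _ => sq_nonneg _
    set M := ∫ x, x ^ 2 ∂(μ.map X)
    rw [Real.norm_eq_abs]
    refine hb.trans ?_
    have h1 : (2 * gm (μ.map X) t (t * X ω + N ω) + N ω ^ 2) / t
        ≤ (t * (8 * t * X ω ^ 2 + 4 * t * M) + 9 * N ω ^ 2) / t := by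
      apply div_le_div_of_nonneg_right _ ht.le
      nlinarith [sq_nonneg (t * X ω - N ω)]
    have h2 : (t * (8 * t * X ω ^ 2 + 4 * t * M) + 9 * N ω ^ 2) / t
        = 8 * t * X ω ^ 2 + 4 * t * M + 9 / t * N ω ^ 2 := by
      field_simp
    have h3 : 9 / t ≤ 18 / s := by
      rw [div_le_div_iff₀ ht hs]; linarith
    have h4 := mul_le_mul_of_nonneg_right h3 (sq_nonneg (N ω))
    have h5 : t * X ω ^ 2 ≤ 2 * s * X ω ^ 2 := mul_le_mul_of_nonneg_right ht2.le (sq_nonneg _)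
    have h6 : t * M ≤ 2 * s * M := mul_le_mul_of_nonneg_right ht2.le hM
    linarith
  · filter_upwards with ω
    intro t _
    exact (hasDerivAt_log_gK hP2 (X ω) (N ω) t).const_add _

lemma continuousOn_gH (hX : Measurable X) (hN : Measurable N)
    (hN_law : μ.map N = gaussianReal 0 1)
    (hX2 : Integrable (fun ω => X ω ^ 2) μ) (b : ℝ) :
    ContinuousOn (gH μ X N) (Set.Icc 0 b) := by
  have : IsProbabilityMeasure (μ.map X) := Measure.isProbabilityMeasure_map hX.aemeasurable
  have hP2 := integrable_map_sq hX hX2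
  have hN2 := integrable_N_sq hN hN_law
  have hM : 0 ≤ ∫ x, x ^ 2 ∂(μ.map X) := integral_nonneg fun _ => sq_nonneg _
  refine continuousOn_of_dominated
    (bound := fun ω => 2 * b ^ 2 * X ω ^ 2 + 3 * N ω ^ 2 + b ^ 2 * ∫ x, x ^ 2 ∂(μ.map X))
    (fun t _ => (integrable_path hX hN hN_law hX2 t).1) ?_
    (((hX2.const_mul _).add (hN2.const_mul _)).add (integrable_const _)) ?_
  · rintro t ⟨ht0, htb⟩
    filter_upwards with ω
    have h1 := abs_log_path_le (N := N) hX hX2 t ω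
    have h2 : t ^ 2 ≤ b ^ 2 := pow_le_pow_left₀ ht0 htb 2
    have h3 := mul_le_mul_of_nonneg_right h2 (sq_nonneg (X ω))
    have h4 := mul_le_mul_of_nonneg_right h2 hM
    rw [Real.norm_eq_abs]
    have h5 := abs_add_le (-(N ω) ^ 2 / 2) (-Real.log (gK (μ.map X) t (t * X ω + N ω)))
    rw [abs_neg (Real.log _)] at h5
    have h6 : |(-(N ω) ^ 2 / 2)| = N ω ^ 2 / 2 := by
      rw [neg_div, abs_neg, abs_of_nonneg (by positivity)]
    have := sq_nonneg (N ω)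
    linarith
  · filter_upwards with ω
    intro t _
    exact ((hasDerivAt_log_gK hP2 (X ω) (N ω) t).const_add _).continuousAt.continuousWithinAt

lemma gH_zero (hX : Measurable X) : gH μ X N 0 = 0 := by
  have : IsProbabilityMeasure (μ.map X) := Measure.isProbabilityMeasure_map hX.aemeasurable
  unfold gH gK gw
  simp [neg_div]

end Deriv

/-- The mutual information of the scalar Gaussian channel equals the accumulated MMSE:
`I(snr) = (1/2) ∫₀^snr mmse(γ) dγ` for every `snr ≥ 0`. -/
theorem mutualInfo_eq_half_integral_mmse
    {Ω : Type*} [MeasurableSpace Ω] (μ : Measure Ω) [IsProbabilityMeasure μ]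
    (X N : Ω → ℝ) (hX : Measurable X) (hN : Measurable N)
    (hXN : IndepFun X N μ)
    (hN_law : μ.map N = gaussianReal 0 1)
    (hX2 : Integrable (fun ω => X ω ^ 2) μ) :
    ∀ snr : ℝ, 0 ≤ snr →
      (mutualInfo μ X (chOut X N snr)).toReal
        = (1 / 2) * ∫ γ in (0 : ℝ)..snr, mmse μ X (chOut X N γ) := by
  intro T hT
  have hmm : ∀ t, 0 ≤ mmse μ X (chOut X N t) := fun t => integral_nonneg fun _ => sq_nonneg _
  have hcont : ContinuousOn (fun t => 2 * gH μ X N (√t)) (Set.Icc 0 T) := by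
    refine ContinuousOn.mul continuousOn_const ?_
    refine (continuousOn_gH hX hN hN_law hX2 (√T)).comp Real.continuous_sqrt.continuousOn ?_
    rintro t ⟨_, ht⟩
    exact ⟨Real.sqrt_nonneg _, Real.sqrt_le_sqrt ht⟩
  have hderiv : ∀ t ∈ Set.Ioo 0 T,
      HasDerivAt (fun t => 2 * gH μ X N (√t)) (mmse μ X (chOut X N t)) t := by
    rintro t ⟨ht, _⟩
    have hs : 0 < √t := Real.sqrt_pos.2 ht
    have h1 := (hasDerivAt_gH hX hN hXN hN_law hX2 hs).comp t (Real.hasDerivAt_sqrt ht.ne')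
    refine (h1.const_mul 2).congr_deriv ?_
    change _ = mmse μ X (fun ω => √t * X ω + N ω)
    field_simp
  have hint : IntervalIntegrable (fun t => mmse μ X (chOut X N t)) volume 0 T := by
    rw [intervalIntegrable_iff_integrableOn_Ioc_of_le hT]
    exact intervalIntegral.integrableOn_deriv_of_nonneg hcont hderiv (fun t _ => hmm t)
  have hFTC := intervalIntegral.integral_eq_sub_of_hasDerivAt_of_le hT hcont hderiv hint
  have hnn : 0 ≤ ∫ γ in (0 : ℝ)..T, mmse μ X (chOut X N γ) :=
    intervalIntegral.integral_nonneg hT fun t _ => hmm t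
  simp only [Real.sqrt_zero, gH_zero hX, mul_zero, sub_zero] at hFTC
  have hI : mutualInfo μ X (chOut X N T) = ENNReal.ofReal (gH μ X N (√T)) :=
    mutualInfo_eq_ofReal_gH hX hN hXN hN_law hX2 (√T)
  rw [hI, ENNReal.toReal_ofReal (by linarith), hFTC]
  ring
end
end

section
/- For every probability distribution of the random vector X with E[‖X‖^2] < ∞, the derivative of the input–output mutual information of the vector Gaussian channel satisfies d/dsnr I(X; √snr · H X + N) = (1/2) · E[‖H X − H E[X | Y; snr]‖^2] for all snr > 0. -/
open MeasureTheory ProbabilityTheory Real Filter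
open scoped ENNReal NNReal Topology

noncomputable section

/-- Output `Y = √snr · H X + N` of the vector Gaussian channel. -/
def chOutV {Ω : Type*} {L K : ℕ} (H : Matrix (Fin L) (Fin K) ℝ) (X : Ω → Fin K → ℝ)
    (N : Ω → Fin L → ℝ) (snr : ℝ) : Ω → Fin L → ℝ :=
  fun ω l => Real.sqrt snr * H.mulVec (X ω) l + N ω l

/-! ### Gaussian shift and the joint law -/

/-- The conditional density of `Y = r • w + N` given `w`, relative to the standard Gaussian. -/
def gd {L : ℕ} (r : ℝ) (w y : Fin L → ℝ) : ℝ :=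
  Real.exp (r * (∑ l, w l * y l) - r ^ 2 * (∑ l, w l ^ 2) / 2)

/-- Standard Gaussian measure on `Fin L → ℝ`. -/
abbrev stdG (L : ℕ) : Measure (Fin L → ℝ) := Measure.pi fun _ : Fin L => gaussianReal 0 1

lemma gd_pos {L : ℕ} (r : ℝ) (w y : Fin L → ℝ) : 0 < gd r w y := Real.exp_pos _

lemma gaussianReal_shift (a : ℝ) :
    (gaussianReal 0 1).map (fun y => a + y) =
      (gaussianReal 0 1).withDensity (fun y => ENNReal.ofReal (Real.exp (a * y - a ^ 2 / 2))) := by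
  rw [gaussianReal_map_const_add, gaussianReal_of_var_ne_zero _ one_ne_zero,
    gaussianReal_of_var_ne_zero _ one_ne_zero,
    ← withDensity_mul _ (by fun_prop) (by fun_prop)]
  congr 1
  ext y
  simp only [Pi.mul_apply, gaussianPDF]
  rw [← ENNReal.ofReal_mul (gaussianPDFReal_nonneg _ _ _)]
  congr 1
  simp only [gaussianPDFReal]
  rw [mul_assoc (_)⁻¹, ← Real.exp_add]
  congr 2
  simp
  ring

lemma stdG_shift {L : ℕ} (r : ℝ) (w : Fin L → ℝ) :
    (stdG L).map (fun n l => r * w l + n l) =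
      (stdG L).withDensity (fun y => ENNReal.ofReal (gd r w y)) := by
  have h1 : (stdG L).map (fun n l => r * w l + n l) =
      Measure.pi fun l => (gaussianReal 0 1).map (fun y => r * w l + y) := by
    have : ∀ l, IsProbabilityMeasure ((gaussianReal 0 1).map (fun y => r * w l + y)) :=
      fun l => Measure.isProbabilityMeasure_map (by fun_prop)
    rw [Measure.pi_map_pi (f := fun l y => r * w l + y)]
    intro l
    fun_prop
  rw [h1]
  have : ∀ l, IsProbabilityMeasure ((gaussianReal 0 1).map (fun y => r * w l + y)) :=
      fun l => Measure.isProbabilityMeasure_map (by fun_prop)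
  refine Measure.pi_eq fun s hs => ?_
  rw [withDensity_apply _ (MeasurableSet.univ_pi hs), ← lintegral_indicator (MeasurableSet.univ_pi hs)]
  have h2 : ∀ y : Fin L → ℝ, (Set.univ.pi s).indicator
      (fun y => ENNReal.ofReal (gd r w y)) y = ∏ l, (s l).indicator
        (fun t => ENNReal.ofReal (Real.exp (r * w l * t - (r * w l) ^ 2 / 2))) (y l) := by
    intro y
    by_cases hy : y ∈ Set.univ.pi s
    · rw [Set.indicator_of_mem hy]
      have : ∀ l, (s l).indicator
        (fun t => ENNReal.ofReal (Real.exp (r * w l * t - (r * w l) ^ 2 / 2))) (y l)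
        = ENNReal.ofReal (Real.exp (r * w l * y l - (r * w l) ^ 2 / 2)) := fun l =>
          Set.indicator_of_mem (hy l (Set.mem_univ l)) _
      simp_rw [this]
      rw [← ENNReal.ofReal_prod_of_nonneg (fun _ _ => (Real.exp_pos _).le), ← Real.exp_sum, gd]
      congr 2
      rw [Finset.sum_sub_distrib, Finset.mul_sum, Finset.mul_sum, Finset.sum_div]
      congr 1
      · exact Finset.sum_congr rfl fun _ _ => by ring
      · exact Finset.sum_congr rfl fun _ _ => by ring
    · rw [Set.indicator_of_notMem hy]
      simp only [Set.mem_pi, Set.mem_univ, true_imp_iff, not_forall] at hy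
      obtain ⟨l, hl⟩ := hy
      exact (Finset.prod_eq_zero (Finset.mem_univ l) (Set.indicator_of_notMem hl _)).symm
  simp_rw [h2]
  have hm : ∀ l, Measurable ((s l).indicator
        (fun t => ENNReal.ofReal (Real.exp (r * w l * t - (r * w l) ^ 2 / 2)))) := fun l =>
    Measurable.indicator (by fun_prop) (hs l)
  rw [lintegral_prod_eq_prod_lintegral_of_indepFun Finset.univ
    (fun l (y : Fin L → ℝ) => (s l).indicator
        (fun t => ENNReal.ofReal (Real.exp (r * w l * t - (r * w l) ^ 2 / 2))) (y l))
    (iIndepFun_pi fun l => (hm l).aemeasurable)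
    (fun l => (hm l).comp (measurable_pi_apply l))]
  refine Finset.prod_congr rfl fun l _ => ?_
  rw [gaussianReal_shift, withDensity_apply _ (hs l), ← lintegral_indicator (hs l)]
  exact (measurePreserving_eval (fun _ : Fin L => gaussianReal 0 1) l).lintegral_comp (hm l)

section Channel

variable {Ω 𝒳 : Type*} [MeasurableSpace Ω] [MeasurableSpace 𝒳] {L : ℕ}

@[fun_prop]
lemma measurable_gd {α : Type*} [MeasurableSpace α] (r : ℝ) {u v : α → Fin L → ℝ}
    (hu : Measurable u) (hv : Measurable v) : Measurable fun a => gd r (u a) (v a) := by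
  unfold gd
  fun_prop

lemma joint_law {μ : Measure Ω} [IsProbabilityMeasure μ] {X : Ω → 𝒳} {N : Ω → Fin L → ℝ}
    {h : 𝒳 → Fin L → ℝ} (hh : Measurable h) (hX : Measurable X) (hN : Measurable N)
    (hXN : IndepFun X N μ) (hNl : μ.map N = stdG L) (r : ℝ) :
    μ.map (fun ω => (X ω, fun l => r * h (X ω) l + N ω l)) =
      ((μ.map X).prod (stdG L)).withDensity (fun z => ENNReal.ofReal (gd r (h z.1) z.2)) := by
  have : IsProbabilityMeasure (μ.map X) := Measure.isProbabilityMeasure_map hX.aemeasurable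
  have h1 : μ.map (fun ω => (X ω, N ω)) = (μ.map X).prod (stdG L) := by
    rw [← hNl]
    exact (indepFun_iff_map_prod_eq_prod_map_map hX.aemeasurable hN.aemeasurable).1 hXN
  have h2 : μ.map (fun ω => (X ω, fun l => r * h (X ω) l + N ω l)) =
      (μ.map (fun ω => (X ω, N ω))).map (fun z => (z.1, fun l => r * h z.1 l + z.2 l)) := by
    rw [Measure.map_map (by fun_prop) (by fun_prop)]
    rfl
  rw [h2, h1]
  refine Measure.ext_of_lintegral _ fun φ hφ => ?_
  rw [lintegral_map hφ (by fun_prop), lintegral_prod _ (by fun_prop),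
    lintegral_withDensity_eq_lintegral_mul _ (by fun_prop) hφ, lintegral_prod _ (by fun_prop)]
  refine lintegral_congr fun x => ?_
  have := stdG_shift r (h x)
  calc ∫⁻ y, φ (x, fun l => r * h x l + y l) ∂stdG L
      = ∫⁻ y, φ (x, y) ∂((stdG L).map (fun n l => r * h x l + n l)) := by
        rw [lintegral_map (by fun_prop) (by fun_prop)]
    _ = _ := by
        rw [this, lintegral_withDensity_eq_lintegral_mul _ (by fun_prop) (by fun_prop)]
        rfl

set_option linter.unusedSectionVars false

/-- The marginal density of `Y`, relative to the standard Gaussian. -/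
def qd (ν : Measure 𝒳) (h : 𝒳 → Fin L → ℝ) (r : ℝ) (y : Fin L → ℝ) : ℝ :=
  ∫ x, gd r (h x) y ∂ν

/-- Numerator of the posterior mean of `f`. -/
def nd (ν : Measure 𝒳) (h : 𝒳 → Fin L → ℝ) (f : 𝒳 → ℝ) (r : ℝ) (y : Fin L → ℝ) : ℝ :=
  ∫ x, f x * gd r (h x) y ∂ν

lemma gd_le (r : ℝ) (w y : Fin L → ℝ) : gd r w y ≤ Real.exp ((∑ l, y l ^ 2) / 2) := by
  unfold gd
  apply Real.exp_le_exp.2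
  have : 0 ≤ ∑ l, (r * w l - y l) ^ 2 := Finset.sum_nonneg fun _ _ => sq_nonneg _
  have h2 : ∑ l, (r * w l - y l) ^ 2 =
      r ^ 2 * (∑ l, w l ^ 2) - 2 * (r * (∑ l, w l * y l)) + ∑ l, y l ^ 2 := by
    simp only [Finset.mul_sum]
    rw [← Finset.sum_sub_distrib, ← Finset.sum_add_distrib]
    exact Finset.sum_congr rfl fun _ _ => by ring
  linarith

section
variable {ν : Measure 𝒳} [IsProbabilityMeasure ν] {h : 𝒳 → Fin L → ℝ}

lemma integrable_mul_gd (hh : Measurable h) {f : 𝒳 → ℝ} (hf : Integrable f ν) (r : ℝ)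
    (y : Fin L → ℝ) : Integrable (fun x => f x * gd r (h x) y) ν := by
  refine hf.mul_bdd (c := Real.exp ((∑ l, y l ^ 2) / 2)) ?_ ?_
  · exact (measurable_gd r hh measurable_const).aestronglyMeasurable
  · refine ae_of_all _ fun x => ?_
    rw [Real.norm_eq_abs, abs_of_pos (gd_pos _ _ _)]
    exact gd_le _ _ _

lemma integrable_gd (hh : Measurable h) (r : ℝ) (y : Fin L → ℝ) :
    Integrable (fun x => gd r (h x) y) ν := by
  simpa using integrable_mul_gd hh (integrable_const (1 : ℝ)) r y

lemma qd_eq_nd (r : ℝ) (y : Fin L → ℝ) : qd ν h r y = nd ν h (fun _ => 1) r y := by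
  simp [qd, nd]

lemma qd_pos (hh : Measurable h) (r : ℝ) (y : Fin L → ℝ) : 0 < qd ν h r y :=
  integral_exp_pos (integrable_gd hh r y)

lemma qd_le (hh : Measurable h) (r : ℝ) (y : Fin L → ℝ) :
    qd ν h r y ≤ Real.exp ((∑ l, y l ^ 2) / 2) := by
  calc qd ν h r y ≤ ∫ x, Real.exp ((∑ l, y l ^ 2) / 2) ∂ν :=
        integral_mono (integrable_gd hh r y) (integrable_const _) fun x => gd_le _ _ _
    _ = _ := by simp

lemma continuous_nd (hh : Measurable h) {f : 𝒳 → ℝ} (hf : Integrable f ν) :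
    Continuous fun p : ℝ × (Fin L → ℝ) => nd ν h f p.1 p.2 := by
  refine continuous_iff_continuousAt.2 fun p => ?_
  unfold nd
  refine continuousAt_of_dominated
    (bound := fun x => |f x| * Real.exp ((∑ l, p.2 l ^ 2) / 2 + 1)) ?_ ?_ ?_ ?_
  · exact Eventually.of_forall fun p => (integrable_mul_gd hh hf p.1 p.2).aestronglyMeasurable
  · have hc : Continuous fun p : ℝ × (Fin L → ℝ) => (∑ l, p.2 l ^ 2) / 2 := by fun_prop
    have := hc.continuousAt.eventually (eventually_lt_nhds (lt_add_one ((∑ l, p.2 l ^ 2) / 2)))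
    filter_upwards [this] with p' hp'
    refine ae_of_all _ fun x => ?_
    rw [norm_mul, Real.norm_eq_abs, Real.norm_eq_abs, abs_of_pos (gd_pos _ _ _)]
    gcongr
    exact (gd_le _ _ _).trans (Real.exp_le_exp.2 hp'.le)
  · exact hf.abs.mul_const _
  · refine ae_of_all _ fun x => ?_
    unfold gd
    fun_prop

lemma continuous_qd (hh : Measurable h) :
    Continuous fun p : ℝ × (Fin L → ℝ) => qd ν h p.1 p.2 := by
  simp_rw [qd_eq_nd]
  exact continuous_nd hh (integrable_const _)

lemma measurable_nd (hh : Measurable h) {f : 𝒳 → ℝ} (hf : Integrable f ν) (r : ℝ) :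
    Measurable (nd ν h f r) :=
  ((continuous_nd hh hf).comp (by fun_prop : Continuous fun y : Fin L → ℝ => (r, y))).measurable

lemma measurable_qd (hh : Measurable h) (r : ℝ) :
    Measurable (qd ν h r) :=
  ((continuous_qd hh).comp (by fun_prop : Continuous fun y : Fin L → ℝ => (r, y))).measurable

/-- Weighted Jensen inequality for the exponential. -/
lemma log_jensen {p a : 𝒳 → ℝ} (hp : Integrable p ν) (hp0 : ∀ x, 0 ≤ p x)
    (hZ : 0 < ∫ x, p x ∂ν) (hap : Integrable (fun x => a x * p x) ν)
    (hep : Integrable (fun x => Real.exp (a x) * p x) ν) :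
    Real.log (∫ x, p x ∂ν) + (∫ x, a x * p x ∂ν) / (∫ x, p x ∂ν) ≤
      Real.log (∫ x, Real.exp (a x) * p x ∂ν) := by
  set Z := ∫ x, p x ∂ν
  set c := (∫ x, a x * p x ∂ν) / Z with hc
  have h1 : Real.exp c * Z ≤ ∫ x, Real.exp (a x) * p x ∂ν := by
    calc Real.exp c * Z = ∫ x, Real.exp c * ((1 - c) * p x + a x * p x) ∂ν := by
          rw [integral_const_mul, integral_add (hp.const_mul _) hap, integral_const_mul]
          have : ∫ x, a x * p x ∂ν = c * Z := by rw [hc]; field_simp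
          rw [this]
          ring
      _ ≤ _ := by
          refine integral_mono (((hp.const_mul _).add hap).const_mul _) hep fun x => ?_
          have h2 : a x - c + 1 ≤ Real.exp (a x - c) := Real.add_one_le_exp _
          have h3 : Real.exp (a x) = Real.exp c * Real.exp (a x - c) := by
            rw [← Real.exp_add]; congr 1; ring
          have h4 := mul_le_mul_of_nonneg_left
            (mul_le_mul_of_nonneg_right h2 (hp0 x)) (Real.exp_pos c).le
          dsimp only
          rw [h3]
          linarith
  have h5 := Real.log_le_log (by positivity) h1
  rw [Real.log_mul (Real.exp_pos c).ne' hZ.ne', Real.log_exp] at h5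
  linarith

/-- Convexity of the log density, with the posterior mean as gradient. -/
lemma log_qd_convex (hh : Measurable h) (hi : ∀ l, Integrable (fun x => h x l) ν)
    (r : ℝ) (y y' : Fin L → ℝ) :
    Real.log (qd ν h r y) +
      r * ∑ l, (nd ν h (fun x => h x l) r y / qd ν h r y) * (y' l - y l) ≤
      Real.log (qd ν h r y') := by
  have e1 : ∀ x, Real.exp (r * ∑ l, h x l * (y' l - y l)) * gd r (h x) y = gd r (h x) y' := by
    intro x
    unfold gd
    rw [← Real.exp_add]
    congr 1
    simp only [mul_sub, Finset.sum_sub_distrib]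
    ring
  have e2 : ∀ x, (r * ∑ l, h x l * (y' l - y l)) * gd r (h x) y =
      ∑ l, (r * (y' l - y l)) * (h x l * gd r (h x) y) := by
    intro x
    rw [Finset.mul_sum, Finset.sum_mul]
    exact Finset.sum_congr rfl fun _ _ => by ring
  have hs : ∀ l ∈ Finset.univ,
      Integrable (fun x => (r * (y' l - y l)) * (h x l * gd r (h x) y)) ν :=
    fun l _ => (integrable_mul_gd hh (hi l) r y).const_mul _
  have := log_jensen (ν := ν) (p := fun x => gd r (h x) y)
    (a := fun x => r * ∑ l, h x l * (y' l - y l))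
    (integrable_gd hh r y) (fun x => (gd_pos _ _ _).le) (qd_pos hh r y)
    (by simp_rw [e2]; exact integrable_finsetSum _ hs)
    (by simp_rw [e1]; exact integrable_gd hh r y')
  simp_rw [e1, e2] at this
  rw [integral_finsetSum _ hs] at this
  simp_rw [integral_const_mul] at this
  refine le_trans (le_of_eq ?_) this
  unfold qd nd
  congr 1
  rw [Finset.mul_sum, Finset.sum_div]
  exact Finset.sum_congr rfl fun _ _ => by ring

lemma log_qd_lower (hh : Measurable h) (hi : ∀ l, MemLp (fun x => h x l) 2 ν)
    (r : ℝ) (y : Fin L → ℝ) :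
    (∑ l, (r * (∫ x, h x l ∂ν)) * y l) - r ^ 2 / 2 * (∫ x, ∑ l, h x l ^ 2 ∂ν) ≤
      Real.log (qd ν h r y) := by
  have hS : Integrable (fun x => ∑ l, h x l ^ 2) ν :=
    integrable_finsetSum _ fun l _ => (hi l).integrable_sq
  have hl : ∀ l ∈ Finset.univ, Integrable (fun x => (r * y l) * h x l) ν :=
    fun l _ => ((hi l).integrable one_le_two).const_mul _
  have e2 : ∀ x, r * (∑ l, h x l * y l) - r ^ 2 * (∑ l, h x l ^ 2) / 2 =
      (∑ l, (r * y l) * h x l) - r ^ 2 / 2 * (∑ l, h x l ^ 2) := by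
    intro x
    rw [Finset.mul_sum]
    congr 1
    · exact Finset.sum_congr rfl fun _ _ => by ring
    · ring
  have := log_jensen (ν := ν) (p := fun x => (1 : ℝ))
    (a := fun x => r * (∑ l, h x l * y l) - r ^ 2 * (∑ l, h x l ^ 2) / 2)
    (integrable_const _) (fun x => zero_le_one) (by simp)
    (by simp_rw [e2, mul_one]; exact (integrable_finsetSum _ hl).sub (hS.const_mul _))
    (by simp_rw [mul_one]; exact integrable_gd hh r y)
  simp only [mul_one, integral_const, smul_eq_mul, probReal_univ, Real.log_one, zero_add,
    div_one] at this
  refine le_trans (le_of_eq ?_) this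
  simp_rw [e2]
  rw [integral_sub (integrable_finsetSum _ hl) (hS.const_mul _), integral_finsetSum _ hl,
    integral_const_mul]
  simp_rw [integral_const_mul]
  congr 1
  exact Finset.sum_congr rfl fun _ _ => by ring

end

/-- Standing assumptions. -/
structure Chan (μ : Measure Ω) (X : Ω → 𝒳) (N : Ω → Fin L → ℝ) (h : 𝒳 → Fin L → ℝ) : Prop where
  hh : Measurable h
  hX : Measurable X
  hN : Measurable N
  hXN : IndepFun X N μ
  hNl : μ.map N = stdG L
  hL2 : ∀ l, MemLp (fun ω => h (X ω) l) 2 μ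

/-- The output. -/
def Yc (X : Ω → 𝒳) (N : Ω → Fin L → ℝ) (h : 𝒳 → Fin L → ℝ) (r : ℝ) : Ω → Fin L → ℝ :=
  fun ω l => r * h (X ω) l + N ω l

namespace Chan

variable {μ : Measure Ω} [IsProbabilityMeasure μ] {X : Ω → 𝒳} {N : Ω → Fin L → ℝ}
  {h : 𝒳 → Fin L → ℝ}

lemma probX (C : Chan μ X N h) : IsProbabilityMeasure (μ.map X) :=
  Measure.isProbabilityMeasure_map C.hX.aemeasurable

lemma measY (C : Chan μ X N h) (r : ℝ) : Measurable (Yc X N h r) := by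
  have := C.hh; have := C.hX; have := C.hN
  unfold Yc
  fun_prop

lemma joint (C : Chan μ X N h) (r : ℝ) : μ.map (fun ω => (X ω, Yc X N h r ω)) =
      ((μ.map X).prod (stdG L)).withDensity (fun z => ENNReal.ofReal (gd r (h z.1) z.2)) :=
  joint_law C.hh C.hX C.hN C.hXN C.hNl r

lemma lawY (C : Chan μ X N h) (r : ℝ) : μ.map (Yc X N h r) =
      (stdG L).withDensity (fun y => ENNReal.ofReal (qd (μ.map X) h r y)) := by
  have := C.probX
  have hh := C.hh
  have h1 : μ.map (Yc X N h r) = (μ.map (fun ω => (X ω, Yc X N h r ω))).map Prod.snd := by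
    rw [Measure.map_map measurable_snd (C.hX.prodMk (C.measY r))]
    rfl
  rw [h1, C.joint]
  refine Measure.ext_of_lintegral _ fun φ hφ => ?_
  have hq := (measurable_qd (ν := μ.map X) hh r)
  rw [lintegral_map hφ (by fun_prop),
    lintegral_withDensity_eq_lintegral_mul _ (by fun_prop) (by fun_prop),
    lintegral_withDensity_eq_lintegral_mul _ (by fun_prop) (by fun_prop),
    lintegral_prod_symm _ (by fun_prop)]
  refine lintegral_congr fun y => ?_
  simp only [Pi.mul_apply]
  rw [lintegral_mul_const _ (by fun_prop), qd,
    ofReal_integral_eq_lintegral_ofReal (integrable_gd hh r y)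
      (ae_of_all _ fun x => (gd_pos _ _ _).le)]

lemma integrable_joint (C : Chan μ X N h) (r : ℝ) {F : 𝒳 × (Fin L → ℝ) → ℝ} (hF : Measurable F) :
    Integrable (fun ω => F (X ω, Yc X N h r ω)) μ ↔
      Integrable (fun z => gd r (h z.1) z.2 * F z) ((μ.map X).prod (stdG L)) := by
  have hh := C.hh
  rw [← Function.comp_def F, ← integrable_map_measure hF.aestronglyMeasurable
    (C.hX.prodMk (C.measY r)).aemeasurable, C.joint,
    integrable_withDensity_iff_integrable_smul' (by fun_prop) (by simp)]
  simp [ENNReal.toReal_ofReal (gd_pos _ _ _).le]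

lemma integral_joint (C : Chan μ X N h) (r : ℝ) {F : 𝒳 × (Fin L → ℝ) → ℝ} (hF : Measurable F) :
    ∫ ω, F (X ω, Yc X N h r ω) ∂μ =
      ∫ z, gd r (h z.1) z.2 * F z ∂((μ.map X).prod (stdG L)) := by
  have hh := C.hh
  rw [← integral_map (φ := fun ω => (X ω, Yc X N h r ω)) (C.hX.prodMk (C.measY r)).aemeasurable
    hF.aestronglyMeasurable, C.joint,
    integral_withDensity_eq_integral_toReal_smul (by fun_prop) (by simp)]
  simp [ENNReal.toReal_ofReal (gd_pos _ _ _).le]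

lemma integrable_Y (C : Chan μ X N h) (r : ℝ) {F : (Fin L → ℝ) → ℝ} (hF : Measurable F) :
    Integrable (fun ω => F (Yc X N h r ω)) μ ↔
      Integrable (fun y => qd (μ.map X) h r y * F y) (stdG L) := by
  have := C.probX
  have hq := (measurable_qd (ν := μ.map X) C.hh r)
  rw [← Function.comp_def F, ← integrable_map_measure hF.aestronglyMeasurable
    (C.measY r).aemeasurable, C.lawY,
    integrable_withDensity_iff_integrable_smul' (by fun_prop) (by simp)]
  simp [ENNReal.toReal_ofReal (qd_pos C.hh _ _).le]

lemma integral_Y (C : Chan μ X N h) (r : ℝ) {F : (Fin L → ℝ) → ℝ} (hF : Measurable F) :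
    ∫ ω, F (Yc X N h r ω) ∂μ = ∫ y, qd (μ.map X) h r y * F y ∂(stdG L) := by
  have := C.probX
  have hq := (measurable_qd (ν := μ.map X) C.hh r)
  rw [← integral_map (φ := Yc X N h r) (C.measY r).aemeasurable
    hF.aestronglyMeasurable, C.lawY,
    integral_withDensity_eq_integral_toReal_smul (by fun_prop) (by simp)]
  simp [ENNReal.toReal_ofReal (qd_pos C.hh _ _).le]

/-- Bayes formula. -/
lemma condExp_eq (C : Chan μ X N h) (r : ℝ) {f : 𝒳 → ℝ} (hf : Measurable f)
    (hfi : Integrable (fun ω => f (X ω)) μ) :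
    (fun ω => nd (μ.map X) h f r (Yc X N h r ω) / qd (μ.map X) h r (Yc X N h r ω)) =ᵐ[μ]
      μ[fun ω => f (X ω) | MeasurableSpace.comap (Yc X N h r) inferInstance] := by
  have := C.probX
  have hh := C.hh
  have hq := (measurable_qd (ν := μ.map X) hh r)
  have hfν : Integrable f (μ.map X) :=
    (integrable_map_measure hf.aestronglyMeasurable C.hX.aemeasurable).2 hfi
  have hn := measurable_nd hh hfν r
  have hA : Integrable (fun z : 𝒳 × (Fin L → ℝ) => gd r (h z.1) z.2 * f z.1)
      ((μ.map X).prod (stdG L)) :=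
    (C.integrable_joint r (F := fun z => f z.1) (by fun_prop)).1 hfi
  have hnd : ∀ y, nd (μ.map X) h f r y = ∫ x, gd r (h x) y * f x ∂(μ.map X) := fun y => by
    simp [nd, mul_comm]
  have hni : Integrable (nd (μ.map X) h f r) (stdG L) := by
    refine hA.integral_prod_right.congr (ae_of_all _ fun y => ?_)
    exact (hnd y).symm
  have hMi : Integrable (fun ω => nd (μ.map X) h f r (Yc X N h r ω) /
      qd (μ.map X) h r (Yc X N h r ω)) μ := by
    refine (C.integrable_Y r (F := fun y => nd (μ.map X) h f r y / qd (μ.map X) h r y)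
      (by fun_prop)).2 ?_
    refine hni.congr (ae_of_all _ fun y => ?_)
    have := (qd_pos (ν := μ.map X) hh r y).ne'
    field_simp
  refine ae_eq_condExp_of_forall_setIntegral_eq (C.measY r).comap_le hfi
    (fun s _ _ => hMi.integrableOn) ?_ ?_
  · rintro s ⟨B, hB, rfl⟩ -
    rw [← integral_indicator (C.measY r hB), ← integral_indicator (C.measY r hB)]
    have e1 : ((Yc X N h r ⁻¹' B).indicator fun ω => nd (μ.map X) h f r (Yc X N h r ω) /
      qd (μ.map X) h r (Yc X N h r ω)) = fun ω => (B.indicator fun y =>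
        nd (μ.map X) h f r y / qd (μ.map X) h r y) (Yc X N h r ω) := by
      classical ext ω; simp [Set.indicator_apply]
    have e2 : ((Yc X N h r ⁻¹' B).indicator fun ω => f (X ω)) = fun ω =>
      (fun z : 𝒳 × (Fin L → ℝ) => B.indicator (fun _ => (1 : ℝ)) z.2 * f z.1)
        (X ω, Yc X N h r ω) := by
      classical ext ω; simp [Set.indicator_apply]
    have mB : Measurable (B.indicator (fun _ => (1 : ℝ))) := measurable_const.indicator hB
    rw [e1, e2, C.integral_Y r (Measurable.indicator (by fun_prop) hB),
      C.integral_joint r (by fun_prop), integral_prod_symm]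
    · refine integral_congr_ae (ae_of_all _ fun y => ?_)
      have := (qd_pos (ν := μ.map X) hh r y).ne'
      by_cases hy : y ∈ B
      · simp only [Set.indicator_of_mem hy, one_mul, hnd]
        field_simp
      · simp [Set.indicator_of_notMem hy]
    · have : (fun z : 𝒳 × (Fin L → ℝ) => gd r (h z.1) z.2 *
          (B.indicator (fun _ => (1 : ℝ)) z.2 * f z.1)) =
          (Prod.snd ⁻¹' B).indicator fun z : 𝒳 × (Fin L → ℝ) => gd r (h z.1) z.2 * f z.1 := by
        classical ext z; simp [Set.indicator_apply]
      rw [this]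
      exact hA.indicator (measurable_snd hB)
  · have : Measurable fun y => nd (μ.map X) h f r y / qd (μ.map X) h r y := by fun_prop
    exact (this.comp (comap_measurable (Yc X N h r))).stronglyMeasurable.aestronglyMeasurable

/-- The posterior mean of the `l`-th coordinate of `h X`. -/
def pm (μ : Measure Ω) (X : Ω → 𝒳) (N : Ω → Fin L → ℝ) (h : 𝒳 → Fin L → ℝ) (r : ℝ) (l : Fin L)
    (ω : Ω) : ℝ :=
  nd (μ.map X) h (fun x => h x l) r (Yc X N h r ω) / qd (μ.map X) h r (Yc X N h r ω)

lemma L2ν (C : Chan μ X N h) (l : Fin L) : MemLp (fun x => h x l) 2 (μ.map X) := by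
  have hh := C.hh
  have : Measurable fun x => h x l := by fun_prop
  exact (memLp_map_measure_iff this.aestronglyMeasurable C.hX.aemeasurable).2 (C.hL2 l)

lemma L1ν (C : Chan μ X N h) (l : Fin L) : Integrable (fun x => h x l) (μ.map X) := by
  have := C.probX
  exact (C.L2ν l).integrable one_le_two

lemma pm_ae (C : Chan μ X N h) (r : ℝ) (l : Fin L) : pm μ X N h r l =ᵐ[μ]
    μ[fun ω => h (X ω) l | MeasurableSpace.comap (Yc X N h r) inferInstance] := by
  have hh := C.hh
  exact C.condExp_eq r (f := fun x => h x l) (by fun_prop) ((C.hL2 l).integrable one_le_two)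

lemma memLp_pm (C : Chan μ X N h) (r : ℝ) (l : Fin L) : MemLp (pm μ X N h r l) 2 μ :=
  (memLp_congr_ae (C.pm_ae r l)).2 ((C.hL2 l).condExp one_le_two)

lemma meas_pm (C : Chan μ X N h) (r : ℝ) (l : Fin L) : Measurable (pm μ X N h r l) := by
  have := C.probX
  exact ((measurable_nd C.hh (C.L1ν l) r).div (measurable_qd C.hh r)).comp (C.measY r)

lemma pm_orth (C : Chan μ X N h) (r : ℝ) (l : Fin L) :
    ∫ ω, pm μ X N h r l ω * h (X ω) l ∂μ = ∫ ω, pm μ X N h r l ω ^ 2 ∂μ := by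
  have := C.probX
  have hm := (C.measY r).comap_le
  have hs : StronglyMeasurable[MeasurableSpace.comap (Yc X N h r) inferInstance]
      (pm μ X N h r l) :=
    (((measurable_nd C.hh (C.L1ν l) r).div (measurable_qd C.hh r)).comp
      (comap_measurable (Yc X N h r))).stronglyMeasurable
  have hi : Integrable (pm μ X N h r l * fun ω => h (X ω) l) μ :=
    (C.memLp_pm r l).integrable_mul (C.hL2 l)
  have h1 := condExp_mul_of_stronglyMeasurable_left hs hi ((C.hL2 l).integrable one_le_two)
  calc ∫ ω, pm μ X N h r l ω * h (X ω) l ∂μ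
      = ∫ ω, (μ[pm μ X N h r l * fun ω => h (X ω) l |
          MeasurableSpace.comap (Yc X N h r) inferInstance]) ω ∂μ := (integral_condExp hm).symm
    _ = _ := by
      refine integral_congr_ae ?_
      filter_upwards [h1, C.pm_ae r l] with ω h1 h2
      rw [h1, Pi.mul_apply, ← h2, sq]

lemma memLp_N (C : Chan μ X N h) (l : Fin L) : MemLp (fun ω => N ω l) 2 μ := by
  have h1 : MemLp (fun y : Fin L → ℝ => y l) 2 (stdG L) :=
    (memLp_id_gaussianReal (μ := 0) (v := 1) 2).comp_measurePreserving
      (measurePreserving_eval (fun _ : Fin L => gaussianReal 0 1) l)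
  rw [← C.hNl] at h1
  exact h1.comp_of_map C.hN.aemeasurable

lemma memLp_Y (C : Chan μ X N h) (r : ℝ) (l : Fin L) : MemLp (fun ω => Yc X N h r ω l) 2 μ :=
  ((C.hL2 l).const_mul r).add (C.memLp_N l)

lemma integrable_log (C : Chan μ X N h) (s t : ℝ) :
    Integrable (fun ω => Real.log (qd (μ.map X) h s (Yc X N h t ω))) μ := by
  have := C.probX
  have hsum : Integrable (fun ω => (∑ l, Yc X N h t ω l ^ 2) / 2) μ :=
    (integrable_finsetSum _ fun l _ => (C.memLp_Y t l).integrable_sq).div_const 2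
  have hlow : Integrable (fun ω => (∑ l, (s * (∫ x, h x l ∂(μ.map X))) * Yc X N h t ω l) -
      s ^ 2 / 2 * (∫ x, ∑ l, h x l ^ 2 ∂(μ.map X))) μ :=
    (integrable_finsetSum _ fun l _ =>
      ((C.memLp_Y t l).integrable one_le_two).const_mul _).sub (integrable_const _)
  refine integrable_of_le_of_le
    (((measurable_qd C.hh s).log.comp (C.measY t)).aestronglyMeasurable)
    (ae_of_all _ fun ω => log_qd_lower C.hh C.L2ν s (Yc X N h t ω))
    (ae_of_all _ fun ω => ?_) hlow hsum
  exact (Real.log_le_iff_le_exp (qd_pos C.hh _ _)).2 (qd_le C.hh _ _)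

lemma integral_qd (C : Chan μ X N h) (r : ℝ) : ∫ y, qd (μ.map X) h r y ∂(stdG L) = 1 := by
  have := C.integral_Y r (F := fun _ => 1) measurable_const
  simpa using this.symm

lemma integrable_qd (C : Chan μ X N h) (r : ℝ) : Integrable (qd (μ.map X) h r) (stdG L) := by
  have := (C.integrable_Y r (F := fun _ => 1) measurable_const).1 (integrable_const _)
  simpa using this

lemma gibbs (C : Chan μ X N h) (s t : ℝ) :
    ∫ ω, Real.log (qd (μ.map X) h s (Yc X N h t ω)) ∂μ ≤
      ∫ ω, Real.log (qd (μ.map X) h t (Yc X N h t ω)) ∂μ := by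
  have := C.probX
  have hF : Measurable fun y => qd (μ.map X) h s y / qd (μ.map X) h t y - 1 :=
    ((measurable_qd C.hh s).div (measurable_qd C.hh t)).sub_const 1
  have e : ∀ y, qd (μ.map X) h t y * (qd (μ.map X) h s y / qd (μ.map X) h t y - 1) =
      qd (μ.map X) h s y - qd (μ.map X) h t y := fun y => by
    have := (qd_pos (ν := μ.map X) C.hh t y).ne'
    field_simp
  have hi : Integrable (fun ω => qd (μ.map X) h s (Yc X N h t ω) /
      qd (μ.map X) h t (Yc X N h t ω) - 1) μ := by
    refine (C.integrable_Y t hF).2 ?_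
    simp_rw [e]
    exact (C.integrable_qd s).sub (C.integrable_qd t)
  have h0 : ∫ ω, (qd (μ.map X) h s (Yc X N h t ω) /
      qd (μ.map X) h t (Yc X N h t ω) - 1) ∂μ = 0 := by
    refine (C.integral_Y t hF).trans ?_
    simp_rw [e]
    rw [integral_sub (C.integrable_qd s) (C.integrable_qd t), C.integral_qd, C.integral_qd, sub_self]
  rw [← sub_nonpos, ← integral_sub (C.integrable_log s t) (C.integrable_log t t), ← h0]
  refine integral_mono ((C.integrable_log s t).sub (C.integrable_log t t)) hi fun ω => ?_
  have p1 := qd_pos (ν := μ.map X) C.hh s (Yc X N h t ω)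
  have p2 := qd_pos (ν := μ.map X) C.hh t (Yc X N h t ω)
  dsimp only
  rw [← Real.log_div p1.ne' p2.ne']
  exact Real.log_le_sub_one_of_pos (by positivity)

/-- The relative entropy of `Y` with respect to the standard Gaussian. -/
def Jf (μ : Measure Ω) (X : Ω → 𝒳) (N : Ω → Fin L → ℝ) (h : 𝒳 → Fin L → ℝ) (r : ℝ) : ℝ :=
  ∫ ω, Real.log (qd (μ.map X) h r (Yc X N h r ω)) ∂μ

/-- The second moment of the posterior mean. -/
def mf (μ : Measure Ω) (X : Ω → 𝒳) (N : Ω → Fin L → ℝ) (h : 𝒳 → Fin L → ℝ) (r : ℝ) : ℝ :=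
  ∫ ω, ∑ l, pm μ X N h r l ω ^ 2 ∂μ

lemma key (C : Chan μ X N h) (s t : ℝ) :
    Jf μ X N h s + s * (t - s) * mf μ X N h s ≤ Jf μ X N h t := by
  have := C.probX
  refine le_trans ?_ (C.gibbs s t)
  have hi : ∀ l ∈ Finset.univ, Integrable (fun ω => pm μ X N h s l ω * h (X ω) l) μ :=
    fun l _ => (C.memLp_pm s l).integrable_mul (C.hL2 l)
  have e : Jf μ X N h s + s * (t - s) * mf μ X N h s =
      ∫ ω, (Real.log (qd (μ.map X) h s (Yc X N h s ω)) +
        s * (t - s) * ∑ l, pm μ X N h s l ω * h (X ω) l) ∂μ := by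
    rw [integral_add (C.integrable_log s s) ((integrable_finsetSum _ hi).const_mul _),
      integral_const_mul, integral_finsetSum _ hi, mf,
      integral_finsetSum _ fun l _ => (C.memLp_pm s l).integrable_sq]
    simp_rw [C.pm_orth]
    rfl
  rw [e]
  refine integral_mono ((C.integrable_log s s).add ((integrable_finsetSum _ hi).const_mul _))
    (C.integrable_log s t) fun ω => ?_
  have := log_qd_convex C.hh C.L1ν s (Yc X N h s ω) (Yc X N h t ω)
  refine le_trans (le_of_eq ?_) this
  dsimp only
  congr 1
  rw [Finset.mul_sum, Finset.mul_sum]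
  refine Finset.sum_congr rfl fun l _ => ?_
  simp only [pm, Yc]
  ring

/-- Minimum mean-square error. -/
lemma mmse_eq (C : Chan μ X N h) (r : ℝ) :
    ∫ ω, ∑ l, (h (X ω) l - pm μ X N h r l ω) ^ 2 ∂μ =
      (∫ ω, ∑ l, h (X ω) l ^ 2 ∂μ) - mf μ X N h r := by
  have hi : ∀ l ∈ Finset.univ, Integrable (fun ω => pm μ X N h r l ω * h (X ω) l) μ :=
    fun l _ => (C.memLp_pm r l).integrable_mul (C.hL2 l)
  have hd : ∀ l ∈ Finset.univ, Integrable (fun ω => (h (X ω) l - pm μ X N h r l ω) ^ 2) μ :=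
    fun l _ => ((C.hL2 l).sub (C.memLp_pm r l)).integrable_sq
  rw [mf, integral_finsetSum _ hd,
    integral_finsetSum _ fun l _ => (C.hL2 l).integrable_sq,
    integral_finsetSum _ fun l _ => (C.memLp_pm r l).integrable_sq, ← Finset.sum_sub_distrib]
  refine Finset.sum_congr rfl fun l _ => ?_
  have e : ∀ ω, (h (X ω) l - pm μ X N h r l ω) ^ 2 =
      h (X ω) l ^ 2 - 2 * (pm μ X N h r l ω * h (X ω) l) + pm μ X N h r l ω ^ 2 :=
    fun ω => by ring
  simp_rw [e]
  rw [integral_add, integral_sub, integral_const_mul, C.pm_orth]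
  · ring
  · exact (C.hL2 l).integrable_sq
  · exact (hi l (Finset.mem_univ l)).const_mul 2
  · exact (C.hL2 l).integrable_sq.sub ((hi l (Finset.mem_univ l)).const_mul 2)
  · exact (C.memLp_pm r l).integrable_sq

lemma continuous_pm (C : Chan μ X N h) (l : Fin L) (ω : Ω) :
    Continuous fun r => pm μ X N h r l ω := by
  have := C.probX
  have hY : Continuous fun r => (r, Yc X N h r ω) := by
    unfold Yc
    fun_prop
  exact ((continuous_nd C.hh (C.L1ν l)).comp hY).div ((continuous_qd C.hh).comp hY)
    fun r => ne_of_gt (qd_pos C.hh _ _)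

/-- The Fatou lemma in the form of lower semicontinuity along a sequence. -/
lemma fatou_aux {F : ℕ → Ω → ℝ} {G : Ω → ℝ} (hF : ∀ n, Integrable (F n) μ)
    (hF0 : ∀ n ω, 0 ≤ F n ω) (hG : Integrable G μ)
    (hlim : ∀ ω, Tendsto (fun n => F n ω) atTop (𝓝 (G ω))) {c : ℝ} (hc : c < ∫ ω, G ω ∂μ) :
    ∀ᶠ n in atTop, c < ∫ ω, F n ω ∂μ := by
  rcases lt_or_ge c 0 with h0 | h0
  · exact Eventually.of_forall fun n => h0.trans_le (integral_nonneg (hF0 n))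
  have hG0 : ∀ ω, 0 ≤ G ω := fun ω => ge_of_tendsto' (hlim ω) fun n => hF0 n ω
  have h1 : ∫⁻ ω, ENNReal.ofReal (G ω) ∂μ ≤
      liminf (fun n => ∫⁻ ω, ENNReal.ofReal (F n ω) ∂μ) atTop := by
    refine le_trans (le_of_eq ?_) (lintegral_liminf_le' fun n => (hF n).aemeasurable.ennreal_ofReal)
    refine lintegral_congr fun ω => ?_
    exact ((ENNReal.tendsto_ofReal (hlim ω)).liminf_eq).symm
  rw [← ofReal_integral_eq_lintegral_ofReal hG (ae_of_all _ hG0)] at h1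
  have h2 : ENNReal.ofReal c < liminf (fun n => ∫⁻ ω, ENNReal.ofReal (F n ω) ∂μ) atTop :=
    lt_of_lt_of_le ((ENNReal.ofReal_lt_ofReal_iff_of_nonneg h0).2 hc) h1
  filter_upwards [eventually_lt_of_lt_liminf h2] with n hn
  rw [← ofReal_integral_eq_lintegral_ofReal (hF n) (ae_of_all _ (hF0 n))] at hn
  exact (ENNReal.ofReal_lt_ofReal_iff_of_nonneg h0).1 hn

lemma continuous_mf (C : Chan μ X N h) : Continuous (mf μ X N h) := by
  refine continuous_iff_seqContinuous.2 fun u r hu => ?_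
  have hpm : ∀ ω l, Tendsto (fun n => pm μ X N h (u n) l ω) atTop (𝓝 (pm μ X N h r l ω)) :=
    fun ω l => ((C.continuous_pm l ω).tendsto r).comp hu
  refine tendsto_order.2 ⟨fun a ha => ?_, fun a ha => ?_⟩
  · refine fatou_aux (fun n => integrable_finsetSum _ fun l _ => (C.memLp_pm (u n) l).integrable_sq)
      (fun n ω => Finset.sum_nonneg fun l _ => sq_nonneg _)
      (integrable_finsetSum _ fun l _ => (C.memLp_pm r l).integrable_sq) (fun ω => ?_) ha
    exact tendsto_finsetSum _ fun l _ => (hpm ω l).pow 2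
  · have hc : (∫ ω, ∑ l, h (X ω) l ^ 2 ∂μ) - a <
        ∫ ω, ∑ l, (h (X ω) l - pm μ X N h r l ω) ^ 2 ∂μ := by
      rw [C.mmse_eq]; linarith
    have := fatou_aux (F := fun n ω => ∑ l, (h (X ω) l - pm μ X N h (u n) l ω) ^ 2)
      (fun n => integrable_finsetSum _ fun l _ =>
        ((C.hL2 l).sub (C.memLp_pm (u n) l)).integrable_sq)
      (fun n ω => Finset.sum_nonneg fun l _ => sq_nonneg _)
      (integrable_finsetSum _ fun l _ => ((C.hL2 l).sub (C.memLp_pm r l)).integrable_sq)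
      (fun ω => tendsto_finsetSum _ fun l _ => (tendsto_const_nhds.sub (hpm ω l)).pow 2) hc
    filter_upwards [this] with n hn
    rw [C.mmse_eq] at hn
    simp only [Function.comp_apply]
    linarith

lemma hasDerivAt_Jf (C : Chan μ X N h) (r : ℝ) :
    HasDerivAt (Jf μ X N h) (r * mf μ X N h r) r := by
  rw [hasDerivAt_iff_tendsto_slope]
  have hc : Tendsto (fun t => t * mf μ X N h t) (𝓝[≠] r) (𝓝 (r * mf μ X N h r)) :=
    ((continuous_id.mul C.continuous_mf).tendsto r).mono_left nhdsWithin_le_nhds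
  have hd : Tendsto (fun t => |t * mf μ X N h t - r * mf μ X N h r|) (𝓝[≠] r) (𝓝 0) := by
    have := (hc.sub_const (r * mf μ X N h r)).abs
    simpa using this
  rw [tendsto_iff_norm_sub_tendsto_zero]
  refine squeeze_zero' (Eventually.of_forall fun _ => norm_nonneg _) ?_ hd
  filter_upwards [self_mem_nhdsWithin] with t ht
  have ht' : t - r ≠ 0 := sub_ne_zero.2 ht
  have k1 := C.key r t
  have k2 := C.key t r
  rw [slope_def_field, Real.norm_eq_abs]
  rcases lt_or_gt_of_ne ht' with hlt | hgt
  · have a1 : (Jf μ X N h t - Jf μ X N h r) / (t - r) ≤ r * mf μ X N h r := by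
      rw [div_le_iff_of_neg hlt]; linarith
    have a2 : t * mf μ X N h t ≤ (Jf μ X N h t - Jf μ X N h r) / (t - r) := by
      rw [le_div_iff_of_neg hlt]; linarith
    rw [abs_of_nonpos (by linarith), abs_of_nonpos (by linarith)]
    linarith
  · have a1 : r * mf μ X N h r ≤ (Jf μ X N h t - Jf μ X N h r) / (t - r) := by
      rw [le_div_iff₀ hgt]; linarith
    have a2 : (Jf μ X N h t - Jf μ X N h r) / (t - r) ≤ t * mf μ X N h t := by
      rw [div_le_iff₀ hgt]; linarith
    rw [abs_of_nonneg (by linarith), abs_of_nonneg (by linarith)]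
    linarith

lemma integral_WN (C : Chan μ X N h) (l : Fin L) : ∫ ω, h (X ω) l * N ω l ∂μ = 0 := by
  have hh := C.hh
  have hi : IndepFun (fun ω => h (X ω) l) (fun ω => N ω l) μ :=
    C.hXN.comp (φ := fun x => h x l) (ψ := fun n : Fin L → ℝ => n l)
      (by fun_prop) (measurable_pi_apply l)
  have hN0 : ∫ ω, N ω l ∂μ = 0 := by
    have e : ∫ ω, N ω l ∂μ = ∫ y : Fin L → ℝ, y l ∂(stdG L) := by
      rw [← C.hNl, integral_map C.hN.aemeasurable (measurable_pi_apply l).aestronglyMeasurable]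
    rw [e]
    have := (measurePreserving_eval (fun _ : Fin L => gaussianReal 0 1) l).map_eq
    calc ∫ y : Fin L → ℝ, y l ∂(stdG L)
        = ∫ t, t ∂((stdG L).map (Function.eval l)) := by
          exact (integral_map (μ := stdG L) (φ := Function.eval l) (f := fun t : ℝ => t)
            (measurable_pi_apply l).aemeasurable measurable_id.aestronglyMeasurable).symm
      _ = 0 := by rw [this, integral_id_gaussianReal]
  have := hi.integral_fun_mul_eq_mul_integral (C.hL2 l).aestronglyMeasurable
    (C.memLp_N l).aestronglyMeasurable
  rw [this, hN0, mul_zero]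

lemma mutualInfo_eq (C : Chan μ X N h) (r : ℝ) :
    (mutualInfo μ X (Yc X N h r)).toReal =
      r ^ 2 / 2 * (∫ ω, ∑ l, h (X ω) l ^ 2 ∂μ) - Jf μ X N h r := by
  have := C.probX
  have hh := C.hh
  have hq := measurable_qd (ν := μ.map X) hh r
  have hYp : IsProbabilityMeasure (μ.map (Yc X N h r)) :=
    Measure.isProbabilityMeasure_map (C.measY r).aemeasurable
  have hXY : Measurable fun ω => (X ω, Yc X N h r ω) := C.hX.prodMk (C.measY r)
  have hPp : IsProbabilityMeasure (μ.map fun ω => (X ω, Yc X N h r ω)) :=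
    Measure.isProbabilityMeasure_map hXY.aemeasurable
  set P := μ.map fun ω => (X ω, Yc X N h r ω) with hP
  set Q := (μ.map X).prod (μ.map (Yc X N h r)) with hQ
  set ρ : 𝒳 × (Fin L → ℝ) → ℝ := fun z => gd r (h z.1) z.2 / qd (μ.map X) h r z.2 with hρ
  have hρm : Measurable ρ := by fun_prop
  have hPQ : P = Q.withDensity (fun z => ENNReal.ofReal (ρ z)) := by
    have hQ' : Q = ((μ.map X).prod (stdG L)).withDensity
        (fun z => ENNReal.ofReal (qd (μ.map X) h r z.2)) := by
      have hsf : SFinite ((stdG L).withDensity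
        (fun y => ENNReal.ofReal (qd (μ.map X) h r y))) := by infer_instance
      rw [hQ, C.lawY, prod_withDensity_right (by fun_prop)]
    rw [hP, C.joint, hQ', ← withDensity_mul _ (by fun_prop) (by fun_prop)]
    congr 1
    ext z
    have hp := qd_pos (ν := μ.map X) hh r z.2
    rw [Pi.mul_apply, ← ENNReal.ofReal_mul hp.le, hρ]
    congr 1
    field_simp
  have hac : P ≪ Q := by
    rw [hPQ]; exact withDensity_absolutelyContinuous _ _
  have hllr : llr P Q =ᵐ[P] fun z => Real.log (ρ z) := by
    have h1 : P.rnDeriv Q =ᵐ[Q] fun z => ENNReal.ofReal (ρ z) := by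
      rw [hPQ]; exact Measure.rnDeriv_withDensity Q (by fun_prop)
    filter_upwards [hac.ae_eq h1] with z hz
    rw [llr, hz, ENNReal.toReal_ofReal
      (div_nonneg (gd_pos _ _ _).le (qd_pos hh _ _).le)]
  have e1 : ∀ ω, Real.log (ρ (X ω, Yc X N h r ω)) =
      (r ^ 2 / 2 * (∑ l, h (X ω) l ^ 2) + r * ∑ l, h (X ω) l * N ω l) -
        Real.log (qd (μ.map X) h r (Yc X N h r ω)) := by
    intro ω
    simp only [hρ]
    rw [Real.log_div (gd_pos _ _ _).ne' (qd_pos hh _ _).ne', gd, Real.log_exp]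
    congr 1
    simp only [Yc, mul_add, Finset.sum_add_distrib]
    have : ∑ l, h (X ω) l * (r * h (X ω) l) = r * ∑ l, h (X ω) l ^ 2 := by
      rw [Finset.mul_sum]
      exact Finset.sum_congr rfl fun _ _ => by ring
    rw [this]
    ring
  have i1 : Integrable (fun ω => ∑ l, h (X ω) l ^ 2) μ :=
    integrable_finsetSum _ fun l _ => (C.hL2 l).integrable_sq
  have i2 : ∀ l ∈ Finset.univ, Integrable (fun ω => h (X ω) l * N ω l) μ :=
    fun l _ => (C.hL2 l).integrable_mul (C.memLp_N l)
  have i3 := C.integrable_log r r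
  have i4 : Integrable (fun ω => Real.log (ρ (X ω, Yc X N h r ω))) μ := by
    simp_rw [e1]
    exact ((i1.const_mul _).add ((integrable_finsetSum _ i2).const_mul _)).sub i3
  have hllrint : Integrable (llr P Q) P := by
    refine (integrable_congr hllr).2 ?_
    rw [hP, integrable_map_measure hρm.log.aestronglyMeasurable hXY.aemeasurable]
    exact i4
  have hval : ∫ z, llr P Q z ∂P =
      r ^ 2 / 2 * (∫ ω, ∑ l, h (X ω) l ^ 2 ∂μ) - Jf μ X N h r := by
    rw [integral_congr_ae hllr, hP, integral_map hXY.aemeasurable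
      hρm.log.aestronglyMeasurable]
    simp_rw [e1]
    have i5 : Integrable (fun ω => r ^ 2 / 2 * (∑ l, h (X ω) l ^ 2) +
        r * ∑ l, h (X ω) l * N ω l) μ :=
      (i1.const_mul _).add ((integrable_finsetSum _ i2).const_mul _)
    rw [integral_sub i5 i3,
      integral_add (i1.const_mul _) ((integrable_finsetSum _ i2).const_mul _),
      integral_const_mul, integral_const_mul, integral_finsetSum _ i2]
    simp [C.integral_WN, Jf]
  have hnn : 0 ≤ ∫ z, llr P Q z ∂P := by
    have := InformationTheory.integral_llr_add_sub_measure_univ_nonneg hac hllrint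
    simpa using this
  rw [mutualInfo, klDiv, if_pos ⟨hac, hllrint⟩, ENNReal.toReal_ofReal hnn, hval]

lemma hasDerivAt_mutualInfo (C : Chan μ X N h) {s : ℝ} (hs : 0 < s) :
    HasDerivAt (fun s : ℝ => (mutualInfo μ X (Yc X N h (√s))).toReal)
      ((∫ ω, ∑ l, (h (X ω) l - pm μ X N h (√s) l ω) ^ 2 ∂μ) / 2) s := by
  have h0 : 0 < √s := Real.sqrt_pos.2 hs
  have h1 : HasDerivAt (fun s => Jf μ X N h (√s))
      ((√s * mf μ X N h (√s)) * (1 / (2 * √s))) s :=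
    (C.hasDerivAt_Jf (√s)).comp s (Real.hasDerivAt_sqrt hs.ne')
  have h2 : HasDerivAt (fun s : ℝ => s / 2 * (∫ ω, ∑ l, h (X ω) l ^ 2 ∂μ))
      (1 / 2 * (∫ ω, ∑ l, h (X ω) l ^ 2 ∂μ)) s :=
    ((hasDerivAt_id s).div_const 2).mul_const _
  have h3 := h2.sub h1
  rw [C.mmse_eq]
  refine (h3.congr_of_eventuallyEq ?_).congr_deriv ?_
  · filter_upwards [eventually_gt_nhds hs] with t ht
    rw [C.mutualInfo_eq, Real.sq_sqrt ht.le]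
    rfl
  · field_simp

end Chan

end Channel

/-- **I-MMSE relation for the vector Gaussian channel** (Theorem 2): with `E[‖X‖²] < ∞`,
`d/dsnr I(X; √snr·H X + N) = (1/2) E[‖H X − H E[X | Y; snr]‖²]` for every `snr > 0`. -/
theorem hasDerivAt_mutualInfo_vector_half_mmse
    {Ω : Type*} [MeasurableSpace Ω] (μ : Measure Ω) [IsProbabilityMeasure μ]
    {L K : ℕ} (H : Matrix (Fin L) (Fin K) ℝ)
    (X : Ω → Fin K → ℝ) (N : Ω → Fin L → ℝ)
    (hX : Measurable X) (hN : Measurable N)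
    (hXN : IndepFun X N μ)
    (hN_law : μ.map N = Measure.pi fun _ : Fin L => gaussianReal 0 1)
    (hX2 : Integrable (fun ω => ∑ k, X ω k ^ 2) μ) :
    ∀ snr ∈ Set.Ioi (0 : ℝ),
      HasDerivAt (fun s : ℝ => (mutualInfo μ X (chOutV H X N s)).toReal)
        ((∫ ω, ∑ l, (H.mulVec (X ω) l -
            H.mulVec (fun k =>
              (μ[fun ω' => X ω' k |
                  MeasurableSpace.comap (chOutV H X N snr) inferInstance]) ω) l) ^ 2 ∂μ) / 2)
        snr := by
  intro snr hsnr
  have hXk : ∀ k, MemLp (fun ω => X ω k) 2 μ := by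
    intro k
    have hm : Measurable fun ω => X ω k := by fun_prop
    refine (memLp_two_iff_integrable_sq hm.aestronglyMeasurable).2 ?_
    refine hX2.mono' (hm.pow_const 2).aestronglyMeasurable (ae_of_all _ fun ω => ?_)
    rw [Real.norm_eq_abs, abs_of_nonneg (sq_nonneg _)]
    exact Finset.single_le_sum (f := fun k => X ω k ^ 2) (fun _ _ => sq_nonneg _)
      (Finset.mem_univ k)
  have hmul : ∀ (v : Fin K → ℝ) l, H.mulVec v l = ∑ k, H l k * v k := fun v l => rfl
  have hHm : Measurable (fun x : Fin K → ℝ => H.mulVec x) := by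
    refine measurable_pi_lambda _ fun l => ?_
    simp_rw [hmul]
    fun_prop
  have C : Chan μ X N (fun x => H.mulVec x) :=
    { hh := hHm, hX := hX, hN := hN, hXN := hXN, hNl := hN_law,
      hL2 := fun l => by
        simp_rw [hmul]
        exact memLp_finsetSum _ fun k _ => (hXk k).const_mul _ }
  have hmain := C.hasDerivAt_mutualInfo hsnr
  have := C.probX
  refine hmain.congr_deriv ?_
  congr 1
  have hce : ∀ᵐ ω ∂μ, ∀ k,
      nd (μ.map X) (fun x => H.mulVec x) (fun x => x k) (√snr)
          (Yc X N (fun x => H.mulVec x) (√snr) ω) /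
        qd (μ.map X) (fun x => H.mulVec x) (√snr) (Yc X N (fun x => H.mulVec x) (√snr) ω) =
      (μ[fun ω' => X ω' k |
        MeasurableSpace.comap (chOutV H X N snr) inferInstance]) ω :=
    ae_all_iff.2 fun k => C.condExp_eq (√snr) (f := fun x => x k) (by fun_prop)
      ((hXk k).integrable one_le_two)
  refine integral_congr_ae ?_
  filter_upwards [hce] with ω hω
  refine Finset.sum_congr rfl fun l _ => ?_
  congr 2
  rw [hmul]
  simp_rw [← hω]
  rw [Chan.pm]
  have hi : ∀ k ∈ Finset.univ, Integrable (fun x : Fin K → ℝ => H l k * (x k *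
      gd (√snr) (H.mulVec x) (Yc X N (fun x => H.mulVec x) (√snr) ω))) (μ.map X) := fun k _ => by
    refine (integrable_mul_gd (f := fun x : Fin K → ℝ => x k) hHm ?_ _ _).const_mul _
    exact (integrable_map_measure (measurable_pi_apply k).aestronglyMeasurable hX.aemeasurable).2
      ((hXk k).integrable one_le_two)
  have e : nd (μ.map X) (fun x => H.mulVec x) (fun x => H.mulVec x l) (√snr)
          (Yc X N (fun x => H.mulVec x) (√snr) ω) =
      ∑ k, H l k * nd (μ.map X) (fun x => H.mulVec x) (fun x => x k) (√snr)
          (Yc X N (fun x => H.mulVec x) (√snr) ω) := by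
    unfold nd
    simp_rw [← integral_const_mul]
    rw [← integral_finsetSum _ hi]
    refine integral_congr_ae (ae_of_all _ fun x => ?_)
    simp only [hmul x l, Finset.sum_mul]
    exact Finset.sum_congr rfl fun _ _ => by ring
  rw [e, Finset.sum_div]
  exact Finset.sum_congr rfl fun _ _ => by ring
end
end
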